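/- arXiv:1903.03870 — 12 statements merged into one kernel-verified Lean document; each statement's English description precedes it below -/
import Mathlib

section
/- If D is a unique factorization domain, then D is an irreducible divisor pair domain (IDPD). -/
/-- An integral domain (here: commutative ring) is *atomic* if every nonzero nonunit
is a finite product of irreducible elements. -/
def IsAtomicDomain (D : Type*) [CommRing D] : Prop :=
  ∀ z : D, z ≠ 0 → ¬IsUnit z →
    ∃ l : Multiset D, (∀ p ∈ l, Irreducible p) ∧ l.prod = z

/-- An *irreducible divisor pair domain (IDPD)* is an atomic integral domain such that
for every nonzero nonunit `z` and every pair of non-associate irreducible divisors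
`p, q` of `z`, there are irreducibles `p', q'` with `p*p' ~ q*q' ∣ z`. -/
def IsIDPD (D : Type*) [CommRing D] : Prop :=
  IsDomain D ∧ IsAtomicDomain D ∧
    ∀ z p q : D, z ≠ 0 → ¬IsUnit z → Irreducible p → Irreducible q →
      p ∣ z → q ∣ z → ¬Associated p q →
      ∃ p' q' : D, Irreducible p' ∧ Irreducible q' ∧
        Associated (p * p') (q * q') ∧ q * q' ∣ z

/-- A *half-factorial domain (HFD)* is an atomic integral domain in which any two
irreducible factorizations of the same element have the same length. -/
def IsHFD (D : Type*) [CommRing D] : Prop :=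
  IsDomain D ∧ IsAtomicDomain D ∧
    ∀ s t : Multiset D, (∀ p ∈ s, Irreducible p) → (∀ q ∈ t, Irreducible q) →
      s.prod = t.prod → Multiset.card s = Multiset.card t

theorem ufd_isIDPD (D : Type*) [CommRing D] [IsDomain D] [UniqueFactorizationMonoid D] :
    IsIDPD D := by
  refine ⟨inferInstance, ?_, ?_⟩
  · intro z hz hu
    obtain ⟨f, hf, hfz, -⟩ := (WfDvdMonoid.not_unit_iff_exists_factors_eq z hz).1 hu
    exact ⟨f, hf, hfz⟩
  · intro z p q hz hu hp hq hpz hqz hpq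
    refine ⟨q, p, hq, hp, by rw [mul_comm], ?_⟩
    obtain ⟨c, rfl⟩ := hqz
    rcases hp.prime.dvd_or_dvd hpz with h | h
    · exact absurd (hp.associated_of_dvd hq h) hpq
    · exact mul_dvd_mul_left q h
end

section
/- An atomic integral domain D is an IDPD if and only if the following condition holds: for every nonzero nonunit z ∈ D that is a finite product of non-prime irreducible elements, and for every pair p, q ∈ D of non-associate non-prime irreducible divisors of z, there exist irreducible elements p', q' ∈ D such that p·p' is associated to q·q' and q·q' divides z. -/
/-- A non-prime irreducible dividing a product of primes times `m` divides `m`. -/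
theorem dvd_of_dvd_primes_mul {D : Type*} [CommRing D] [IsDomain D] {p m : D}
    (hp : Irreducible p) (hnp : ¬Prime p) (s : Multiset D) :
    (∀ r ∈ s, Prime r) → p ∣ s.prod * m → p ∣ m := by
  induction s using Multiset.induction_on with
  | empty => intro _ h; simpa using h
  | cons a s ih =>
    intro hs h
    have ha : Prime a := hs a (Multiset.mem_cons_self a s)
    refine ih (fun r hr => hs r (Multiset.mem_cons_of_mem hr)) ?_
    rw [Multiset.prod_cons, mul_assoc] at h
    obtain ⟨c, hc⟩ := h
    rcases ha.dvd_or_dvd (Dvd.intro _ hc) with h1 | ⟨d, rfl⟩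
    · exact absurd ((ha.irreducible.associated_of_dvd hp h1).prime ha) hnp
    · refine ⟨d, mul_left_cancel₀ ha.ne_zero ?_⟩
      rw [hc]; ring

/-- A prime and a non-associate irreducible divisor of `z` jointly divide `z`. -/
theorem mul_dvd_of_prime_dvd {D : Type*} [CommRing D] [IsDomain D] {p q z : D}
    (hp : Prime p) (hq : Irreducible q) (hpz : p ∣ z) (hqz : q ∣ z)
    (h : ¬Associated p q) : q * p ∣ z := by
  obtain ⟨w, rfl⟩ := hqz
  rcases hp.dvd_or_dvd hpz with h1 | h1
  · exact absurd (hp.irreducible.associated_of_dvd hq h1) h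
  · exact mul_dvd_mul_left q h1

/-- Prime-free characterization of IDPDs (Proposition 2.1). -/
theorem isIDPD_iff_prime_free (D : Type*) [CommRing D] [IsDomain D]
    (hatomic : IsAtomicDomain D) :
    IsIDPD D ↔
      ∀ z p q : D, z ≠ 0 → ¬IsUnit z →
        (∃ l : Multiset D, (∀ r ∈ l, Irreducible r ∧ ¬Prime r) ∧ l.prod = z) →
        Irreducible p → ¬Prime p → Irreducible q → ¬Prime q →
        p ∣ z → q ∣ z → ¬Associated p q →
        ∃ p' q' : D, Irreducible p' ∧ Irreducible q' ∧
          Associated (p * p') (q * q') ∧ q * q' ∣ z := by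
  classical
  constructor
  · rintro ⟨_, _, h⟩ z p q hz hu _ hp _ hq _ hpz hqz hn
    exact h z p q hz hu hp hq hpz hqz hn
  · intro h
    refine ⟨inferInstance, hatomic, ?_⟩
    intro z p q hz hu hp hq hpz hqz hn
    by_cases hpp : Prime p
    · refine ⟨q, p, hq, hp, ?_, mul_dvd_of_prime_dvd hpp hq hpz hqz hn⟩
      rw [mul_comm]
    by_cases hqp : Prime q
    · refine ⟨q, p, hq, hp, ?_, ?_⟩
      · rw [mul_comm]
      · rw [mul_comm]
        exact mul_dvd_of_prime_dvd hqp hp hqz hpz (fun e => hn e.symm)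
    obtain ⟨l, hl, rfl⟩ := hatomic z hz hu
    have key : (l.filter (fun r => Prime r)).prod * (l.filter (fun r => ¬Prime r)).prod
        = l.prod := by
      rw [← Multiset.prod_add, Multiset.filter_add_not]
    rw [← key] at hpz hqz
    have hpm := dvd_of_dvd_primes_mul hp hpp _
      (fun r hr => (Multiset.mem_filter.1 hr).2) hpz
    have hqm := dvd_of_dvd_primes_mul hq hqp _
      (fun r hr => (Multiset.mem_filter.1 hr).2) hqz
    rw [← key] at hz
    obtain ⟨p', q', h1, h2, h3, h4⟩ := h _ p q (right_ne_zero_of_mul hz)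
      (fun e => hp.not_isUnit (isUnit_of_dvd_unit hpm e))
      ⟨_, fun r hr => ⟨hl r (Multiset.mem_filter.1 hr).1, (Multiset.mem_filter.1 hr).2⟩, rfl⟩
      hp hpp hq hqp hpm hqm hn
    exact ⟨p', q', h1, h2, h3, key ▸ h4.mul_left _⟩
end

section
/- If D is an IDPD, then D is a half-factorial domain (HFD); in particular, D is a bounded factorization domain (BFD). -/
/-- A *bounded factorization domain (BFD)* is an atomic integral domain in which the
lengths of irreducible factorizations of each fixed nonzero nonunit are bounded. -/
def IsBFD (D : Type*) [CommRing D] : Prop :=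
  IsDomain D ∧ IsAtomicDomain D ∧
    ∀ z : D, z ≠ 0 → ¬IsUnit z →
      ∃ N : ℕ, ∀ l : Multiset D, (∀ p ∈ l, Irreducible p) → l.prod = z →
        Multiset.card l ≤ N

theorem isIDPD_aux (D : Type*) [CommRing D] [IsDomain D] (hA : IsAtomicDomain D)
    (hP : ∀ z p q : D, z ≠ 0 → ¬IsUnit z → Irreducible p → Irreducible q →
      p ∣ z → q ∣ z → ¬Associated p q →
      ∃ p' q' : D, Irreducible p' ∧ Irreducible q' ∧
        Associated (p * p') (q * q') ∧ q * q' ∣ z) (n : ℕ) :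
    ∀ s t : Multiset D, (∀ p ∈ s, Irreducible p) → (∀ q ∈ t, Irreducible q) →
      Associated s.prod t.prod → Multiset.card s = n → Multiset.card t = n := by
  induction n with
  | zero =>
    intro s t hs ht hst hc
    rw [Multiset.card_eq_zero] at hc ⊢
    subst hc
    by_contra hne
    obtain ⟨q, hq⟩ := Multiset.exists_mem_of_ne_zero hne
    have hu : IsUnit t.prod := hst.isUnit (by simp)
    exact (ht q hq).not_isUnit (isUnit_of_dvd_unit (Multiset.dvd_prod hq) hu)
  | succ n ih =>
    intro s t hs ht hst hc
    obtain ⟨p, hps⟩ := Multiset.exists_mem_of_ne_zero (s := s) (by rintro rfl; simp at hc)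
    obtain ⟨s', rfl⟩ := Multiset.exists_cons_of_mem hps
    have hp := hs p (by simp)
    have hs' : ∀ x ∈ s', Irreducible x := fun x hx => hs x (by simp [hx])
    have hc' : Multiset.card s' = n := by simpa using hc
    have htne : t ≠ 0 := by
      rintro rfl
      have hu : IsUnit (p ::ₘ s').prod := hst.symm.isUnit (by simp)
      exact hp.not_isUnit (isUnit_of_dvd_unit (Multiset.dvd_prod (by simp)) hu)
    obtain ⟨q, hqt⟩ := Multiset.exists_mem_of_ne_zero htne
    obtain ⟨t', rfl⟩ := Multiset.exists_cons_of_mem hqt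
    have hq := ht q (by simp)
    have ht' : ∀ x ∈ t', Irreducible x := fun x hx => ht x (by simp [hx])
    rw [Multiset.prod_cons, Multiset.prod_cons] at hst
    rw [Multiset.card_cons]
    congr 1
    by_cases hpq : Associated p q
    · exact ih s' t' hs' ht' (hst.of_mul_left hpq hp.ne_zero) hc'
    · have ht0 : t'.prod ≠ 0 := Multiset.prod_ne_zero fun h => (ht' 0 h).ne_zero rfl
      have hz0 : q * t'.prod ≠ 0 := mul_ne_zero hq.ne_zero ht0
      obtain ⟨p', q', hp', hq', hpq', w, hw⟩ := hP (q * t'.prod) p q hz0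
        (fun h => hq.not_isUnit (isUnit_of_mul_isUnit_left h)) hp hq
        ((Dvd.intro _ rfl).trans hst.dvd) (Dvd.intro _ rfl) hpq
      have hw0 : w ≠ 0 := by
        rintro rfl
        exact hz0 (by rw [hw, mul_zero])
      obtain ⟨l, hl, hlw⟩ : ∃ l : Multiset D, (∀ x ∈ l, Irreducible x) ∧
          Associated l.prod w := by
        by_cases hu : IsUnit w
        · exact ⟨0, by simp, by simpa using (associated_one_iff_isUnit.2 hu).symm⟩
        · obtain ⟨l, hl, h⟩ := hA w hw0 hu
          exact ⟨l, hl, h ▸ Associated.refl _⟩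
      have e1 : t'.prod = q' * w := mul_left_cancel₀ hq.ne_zero (by rw [hw, mul_assoc])
      have e2 : Associated s'.prod (p' ::ₘ l).prod := by
        rw [Multiset.prod_cons]
        refine Associated.trans ?_ (hlw.symm.mul_left p')
        refine Associated.of_mul_left (a := p) (c := p) ?_ (Associated.refl p) hp.ne_zero
        rw [hw] at hst
        rw [← mul_assoc]
        exact hst.trans (hpq'.symm.mul_right w)
      have h1 := ih s' (p' ::ₘ l) hs'
        (by intro x hx; rcases Multiset.mem_cons.1 hx with rfl | h; exacts [hp', hl x h]) e2 hc'
      refine ih (q' ::ₘ l) t'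
        (by intro x hx; rcases Multiset.mem_cons.1 hx with rfl | h; exacts [hq', hl x h]) ht' ?_
        (by simpa using h1)
      rw [Multiset.prod_cons, e1]
      exact hlw.mul_left q'

/-- Every IDPD is an HFD, and in particular a BFD (Theorem 2.2). -/
theorem isIDPD_imp_isHFD_and_isBFD (D : Type*) [CommRing D] (hD : IsIDPD D) :
    IsHFD D ∧ IsBFD D := by
  obtain ⟨hdom, hA, hP⟩ := hD
  have key := isIDPD_aux D hA hP
  refine ⟨⟨hdom, hA, fun s t hs ht h => (key _ s t hs ht (h ▸ Associated.refl _) rfl).symm⟩,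
    hdom, hA, fun z hz hu => ?_⟩
  obtain ⟨l, hl, h⟩ := hA z hz hu
  exact ⟨Multiset.card l, fun m hm h' =>
    (key _ l m hl hm (by rw [h, h']) rfl).le⟩
end

section
/- Let K be a field and F ⊆ K a subfield. Then the subring D = F + XK[X] of the polynomial ring K[X], consisting of all polynomials over K whose constant coefficient lies in F, is an IDPD. -/
/-- The subring `F + X·K[X]` of `K[X]`: polynomials over `K` whose constant
coefficient lies in the subfield `F`. -/
def constCoeffInSubfield (K : Type*) [Field K] (F : Subfield K) : Subring (Polynomial K) where
  carrier := {f | f.coeff 0 ∈ F}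
  mul_mem' := by
    intro a b ha hb
    simpa [Polynomial.mul_coeff_zero] using mul_mem ha hb
  one_mem' := by simpa using one_mem F
  add_mem' := by
    intro a b ha hb
    simpa using F.add_mem ha hb
  zero_mem' := by simpa using zero_mem F
  neg_mem' := by
    intro a ha
    simpa using F.neg_mem ha

namespace CCS

open Polynomial

variable {K : Type*} [Field K] {F : Subfield K}

lemma mem_iff {f : K[X]} : f ∈ constCoeffInSubfield K F ↔ f.coeff 0 ∈ F := Iff.rfl

lemma exists_scale {a b : K} (h : a * b ∈ F) : ∃ c : K, c ≠ 0 ∧ c * a ∈ F ∧ c⁻¹ * b ∈ F := by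
  by_cases ha : a = 0
  · by_cases hb : b = 0
    · exact ⟨1, one_ne_zero, by simp [ha, F.zero_mem], by simp [hb, F.zero_mem]⟩
    · exact ⟨b, hb, by simp [ha, F.zero_mem], by simp [hb, F.one_mem]⟩
  · exact ⟨a⁻¹, inv_ne_zero ha, by simp [ha, F.one_mem], by simpa using h⟩

lemma isUnit_iff (f : constCoeffInSubfield K F) : IsUnit f ↔ IsUnit (f : K[X]) := by
  constructor
  · intro h
    exact h.map (constCoeffInSubfield K F).subtype
  · intro h
    obtain ⟨c, hc, hcf⟩ := Polynomial.isUnit_iff.1 h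
    have hm : c ∈ F := by
      have := f.2
      rw [← hcf, mem_iff] at this
      simpa using this
    refine IsUnit.of_mul_eq_one
      (⟨C c⁻¹, by rw [mem_iff]; simpa using hm⟩ : constCoeffInSubfield K F) ?_
    apply Subtype.ext
    change (f : K[X]) * C c⁻¹ = 1
    rw [← hcf, ← C_mul, mul_inv_cancel₀ hc.ne_zero, C_1]

lemma irred_iff (f : constCoeffInSubfield K F) : Irreducible f ↔ Irreducible (f : K[X]) := by
  constructor
  · intro h
    refine ⟨fun hu => h.not_isUnit ((isUnit_iff f).2 hu), ?_⟩
    intro g k hgk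
    have hm : g.coeff 0 * k.coeff 0 ∈ F := by
      rw [← mul_coeff_zero, ← hgk]; exact f.2
    obtain ⟨c, hc, h1, h2⟩ := exists_scale hm
    have hu : IsUnit (C c : K[X]) := isUnit_C.2 hc.isUnit
    have hu' : IsUnit (C c⁻¹ : K[X]) := isUnit_C.2 (inv_ne_zero hc).isUnit
    have := h.isUnit_or_isUnit (a := ⟨C c * g, by rw [mem_iff]; simpa using h1⟩)
      (b := ⟨C c⁻¹ * k, by rw [mem_iff]; simpa using h2⟩) (by
        apply Subtype.ext
        change (f : K[X]) = (C c * g) * (C c⁻¹ * k)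
        have e : (C c : K[X]) * C c⁻¹ = 1 := by rw [← C_mul, mul_inv_cancel₀ hc, C_1]
        rw [hgk]
        linear_combination (-(g * k)) * e)
    rw [isUnit_iff, isUnit_iff] at this
    exact this.imp (fun h => (IsUnit.mul_iff.1 h).2) (fun h => (IsUnit.mul_iff.1 h).2)
  · intro h
    refine ⟨fun hu => h.not_isUnit ((isUnit_iff f).1 hu), ?_⟩
    intro g k hgk
    rw [isUnit_iff, isUnit_iff]
    exact h.isUnit_or_isUnit (congrArg Subtype.val hgk)

lemma atomic : IsAtomicDomain (constCoeffInSubfield K F) := by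
  have key : ∀ n : ℕ, ∀ z : constCoeffInSubfield K F, (z : K[X]).natDegree = n → z ≠ 0 →
      ¬IsUnit z → ∃ l : Multiset (constCoeffInSubfield K F),
        (∀ p ∈ l, Irreducible p) ∧ l.prod = z := by
    intro n
    induction n using Nat.strong_induction_on with
    | _ n ih =>
      intro z hn hz hu
      by_cases hi : Irreducible z
      · exact ⟨{z}, by simpa using hi, by simp⟩
      · rw [irreducible_iff] at hi
        push Not at hi
        obtain ⟨a, b, hab, ha, hb⟩ := hi hu
        have ha0 : a ≠ 0 := by rintro rfl; exact hz (by simpa using hab)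
        have hb0 : b ≠ 0 := by rintro rfl; exact hz (by simpa using hab)
        have pos : ∀ x : constCoeffInSubfield K F, x ≠ 0 → ¬ IsUnit x →
            0 < (x : K[X]).natDegree := by
          intro x hx hxu
          by_contra hd
          have hx' : (x : K[X]) ≠ 0 := fun h => hx (Subtype.ext h)
          apply hxu
          rw [isUnit_iff]
          exact Polynomial.isUnit_iff_degree_eq_zero.2
            (by rw [degree_eq_natDegree hx', Nat.eq_zero_of_not_pos hd]; rfl)
        have hd : (z : K[X]).natDegree = (a : K[X]).natDegree + (b : K[X]).natDegree := by
          rw [hab]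
          exact natDegree_mul (fun h => ha0 (Subtype.ext h)) (fun h => hb0 (Subtype.ext h))
        have := pos a ha0 ha
        have := pos b hb0 hb
        obtain ⟨l, hl, hl'⟩ := ih _ (by omega) a rfl ha0 ha
        obtain ⟨m, hm, hm'⟩ := ih _ (by omega) b rfl hb0 hb
        refine ⟨l + m, ?_, by rw [Multiset.prod_add, hl', hm', hab]⟩
        intro p hp
        rcases Multiset.mem_add.1 hp with h | h
        exacts [hl p h, hm p h]
  exact fun z => key _ z rfl

lemma eq_C_mul_X {p : K[X]} (hp : Irreducible p) (h0 : p.coeff 0 = 0) :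
    ∃ a : K, a ≠ 0 ∧ p = C a * X := by
  obtain ⟨g, hg⟩ := X_dvd_iff.2 h0
  have hu := (hp.isUnit_or_isUnit hg).resolve_left not_isUnit_X
  obtain ⟨a, ha, rfl⟩ := Polynomial.isUnit_iff.1 hu
  exact ⟨a, ha.ne_zero, by rw [hg, mul_comm]⟩

lemma mem_of_mul {a b : K} (ha : a ∈ F) (h0 : a ≠ 0) (h : a * b ∈ F) : b ∈ F := by
  have := F.mul_mem (F.inv_mem ha) h
  rwa [inv_mul_cancel_left₀ h0] at this

lemma irred_C_mul_X {a : K} (ha : a ≠ 0) : Irreducible (C a * X : K[X]) :=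
  (irreducible_isUnit_mul (isUnit_C.2 ha.isUnit)).2 irreducible_X

lemma assoc_of {p q : constCoeffInSubfield K F} {c : K} (hc : c ∈ F) (hc0 : c ≠ 0)
    (h : (p : K[X]) * C c = q) : Associated p q := by
  have hu : IsUnit (⟨C c, by rw [mem_iff]; simpa using hc⟩ : constCoeffInSubfield K F) := by
    rw [isUnit_iff]; exact isUnit_C.2 hc0.isUnit
  exact ⟨hu.unit, Subtype.ext h⟩

/-- Both atoms are multiples of `X`. -/
lemma case_X {z p q u v : constCoeffInSubfield K F} (hzu : z = p * u) (hzv : z = q * v)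
    {a b : K} (ha : a ≠ 0) (hb : b ≠ 0) (hpa : (p : K[X]) = C a * X)
    (hqb : (q : K[X]) = C b * X) (hn : ¬ Associated p q) :
    ∃ p' q' : constCoeffInSubfield K F, Irreducible p' ∧ Irreducible q' ∧
        Associated (p * p') (q * q') ∧ q * q' ∣ z := by
  have e1 : (z : K[X]) = C a * X * (u : K[X]) := by rw [hzu, ← hpa]; rfl
  have e2 : (z : K[X]) = C b * X * (v : K[X]) := by rw [hzv, ← hqb]; rfl
  have e3 : C a * (u : K[X]) = C b * v := by
    apply mul_left_cancel₀ (X_ne_zero (R := K))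
    linear_combination e2 - e1
  have e4 : a * (u : K[X]).coeff 0 = b * (v : K[X]).coeff 0 := by
    simpa using congrArg (fun f => coeff f 0) e3
  have hv0 : (v : K[X]).coeff 0 = 0 := by
    by_contra hv
    have hu0 : (u : K[X]).coeff 0 ≠ 0 := by
      intro h
      rw [h, mul_zero] at e4
      exact mul_ne_zero hb hv e4.symm
    have hvm : (v : K[X]).coeff 0 ∈ F := v.2
    have hum : (u : K[X]).coeff 0 ∈ F := u.2
    have hb' : b = a * ((u : K[X]).coeff 0 / (v : K[X]).coeff 0) := by
      field_simp
      exact e4.symm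
    apply hn
    refine assoc_of (F.div_mem hum hvm) (div_ne_zero hu0 hv) ?_
    rw [hpa, hqb]
    conv_rhs => rw [hb', C_mul]
    ring
  obtain ⟨w, hw⟩ := X_dvd_iff.2 hv0
  obtain ⟨e, he, hem⟩ : ∃ e : K, e ≠ 0 ∧ e⁻¹ * (b * w.coeff 0) ∈ F := by
    by_cases h : b * w.coeff 0 = 0
    · exact ⟨1, one_ne_zero, by simp [h, F.zero_mem]⟩
    · exact ⟨_, h, by rw [inv_mul_cancel₀ h]; exact F.one_mem⟩
  have hXm : ∀ c : K, (C c * X : K[X]) ∈ constCoeffInSubfield K F := by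
    intro c; rw [mem_iff]; simp [F.zero_mem]
  have hce : ∀ c : K, c ≠ 0 → (C c : K[X]) * C (c⁻¹ * e) = C e := by
    intro c hc; rw [← C_mul, mul_inv_cancel_left₀ hc]
  refine ⟨⟨_, hXm (a⁻¹ * e)⟩, ⟨_, hXm (b⁻¹ * e)⟩, ?_, ?_, ?_, ?_⟩
  · rw [irred_iff]; exact irred_C_mul_X (mul_ne_zero (inv_ne_zero ha) he)
  · rw [irred_iff]; exact irred_C_mul_X (mul_ne_zero (inv_ne_zero hb) he)
  · refine Associated.of_eq (Subtype.ext ?_)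
    change (p : K[X]) * (C (a⁻¹ * e) * X) = (q : K[X]) * (C (b⁻¹ * e) * X)
    rw [hpa, hqb]
    linear_combination X ^ 2 * (hce a ha) - X ^ 2 * (hce b hb)
  · refine ⟨⟨C e⁻¹ * (C b * w), by rw [mem_iff]; simpa using hem⟩, Subtype.ext ?_⟩
    change (z : K[X]) = (q : K[X]) * (C (b⁻¹ * e) * X) * (C e⁻¹ * (C b * w))
    have h1 : (C e : K[X]) * C e⁻¹ = 1 := by rw [← C_mul, mul_inv_cancel₀ he, C_1]
    rw [e2, hqb, hw]
    linear_combination (-(X ^ 2 * C e⁻¹ * C b * w)) * (hce b hb) - X ^ 2 * C b * w * h1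

end CCS

/-- `F + X·K[X]` is an IDPD (Theorem 2.4). -/
theorem constCoeffInSubfield_isIDPD (K : Type*) [Field K] (F : Subfield K) :
    IsIDPD (constCoeffInSubfield K F) := by
  refine ⟨inferInstance, CCS.atomic, ?_⟩
  intro z p q hz _ hp hq hpz hqz hn
  obtain ⟨u, hu⟩ := hpz
  obtain ⟨v, hv⟩ := hqz
  have hp' := (CCS.irred_iff p).1 hp
  have hq' := (CCS.irred_iff q).1 hq
  by_cases h00 : (p : Polynomial K).coeff 0 = 0 ∧ (q : Polynomial K).coeff 0 = 0
  · obtain ⟨a, ha, hpa⟩ := CCS.eq_C_mul_X hp' h00.1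
    obtain ⟨b, hb, hqb⟩ := CCS.eq_C_mul_X hq' h00.2
    exact CCS.case_X hu hv ha hb hpa hqb hn
  have e1 : (z : Polynomial K) = p * u := by rw [hu]; rfl
  have e2 : (z : Polynomial K) = q * v := by rw [hv]; rfl
  have hna : ¬ Associated (p : Polynomial K) q := by
    rintro ⟨c, hc⟩
    obtain ⟨a, ha, hac⟩ := Polynomial.isUnit_iff.1 c.isUnit
    rw [← hac] at hc
    have h0 : (p : Polynomial K).coeff 0 * a = (q : Polynomial K).coeff 0 := by
      rw [← hc]; simp
    have hp0 : (p : Polynomial K).coeff 0 ≠ 0 := by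
      intro h
      exact h00 ⟨h, by rw [← h0, h, zero_mul]⟩
    have haF : a ∈ F := CCS.mem_of_mul p.2 hp0 (by rw [h0]; exact q.2)
    exact hn (CCS.assoc_of haF ha.ne_zero hc)
  have hpq : (p : Polynomial K) ∣ v := by
    have : (p : Polynomial K) ∣ q * v := ⟨u, by rw [← e2, e1]⟩
    refine (hp'.prime.dvd_or_dvd this).resolve_left ?_
    exact fun h => hna (hp'.associated_of_dvd hq' h)
  obtain ⟨w, hw⟩ := hpq
  have hu' : (u : Polynomial K) = q * w := by
    apply mul_left_cancel₀ hp'.ne_zero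
    rw [← e1, e2, hw]; ring
  have hwm : w.coeff 0 ∈ F := by
    have hvm : (v : Polynomial K).coeff 0 ∈ F := v.2
    have hum : (u : Polynomial K).coeff 0 ∈ F := u.2
    rw [hw, Polynomial.mul_coeff_zero] at hvm
    rw [hu', Polynomial.mul_coeff_zero] at hum
    by_cases h : (p : Polynomial K).coeff 0 = 0
    · exact CCS.mem_of_mul q.2 (fun h' => h00 ⟨h, h'⟩) hum
    · exact CCS.mem_of_mul p.2 h hvm
  refine ⟨q, p, hq, hp, Associated.of_eq (mul_comm _ _), ⟨w, hwm⟩, Subtype.ext ?_⟩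
  change (z : Polynomial K) = q * p * w
  rw [e2, hw]; ring
end

section
/- The ring ℤ[√−3] (the quadratic integer ring consisting of elements a + b√−3 with a, b ∈ ℤ) is an IDPD. -/
namespace ZNegThree

lemma nrm (x : Zsqrtd (-3)) : x.norm = x.re ^ 2 + 3 * x.im ^ 2 := by
  rw [Zsqrtd.norm_def]; ring

lemma nrm_nonneg (x : Zsqrtd (-3)) : 0 ≤ x.norm := Zsqrtd.norm_nonneg (by norm_num) x

lemma nrm_zero (x : Zsqrtd (-3)) : x.norm = 0 ↔ x = 0 := Zsqrtd.norm_eq_zero_iff (by norm_num) x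

lemma nrm_unit (x : Zsqrtd (-3)) : x.norm = 1 ↔ IsUnit x :=
  Zsqrtd.norm_eq_one_iff' (by norm_num) x

lemma nrm_parity (x : Zsqrtd (-3)) : x.norm % 2 = (x.re + x.im) % 2 := by
  rw [nrm]
  rcases Int.emod_two_eq_zero_or_one x.re with h | h <;>
  rcases Int.emod_two_eq_zero_or_one x.im with h' | h' <;>
  simp [pow_two, Int.add_emod, Int.mul_emod, h, h']

lemma dom : IsDomain (Zsqrtd (-3)) := by
  have : NoZeroDivisors (Zsqrtd (-3)) := ⟨by
    intro a b h
    have h2 : a.norm * b.norm = 0 := by rw [← Zsqrtd.norm_mul, h, Zsqrtd.norm_zero]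
    rcases mul_eq_zero.1 h2 with h | h
    · exact Or.inl ((nrm_zero a).1 h)
    · exact Or.inr ((nrm_zero b).1 h)⟩
  exact NoZeroDivisors.to_isDomain _

lemma atomic : IsAtomicDomain (Zsqrtd (-3)) := by
  intro z
  induction hn : z.norm.toNat using Nat.strong_induction_on generalizing z with
  | _ n ih =>
  intro hz hu
  by_cases hirr : Irreducible z
  · exact ⟨{z}, by simpa using hirr, by simp⟩
  · rw [irreducible_iff] at hirr
    push Not at hirr
    obtain ⟨a, b, hab, ha, hb⟩ := hirr hu
    have ha0 : a ≠ 0 := by rintro rfl; simp at hab; exact hz hab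
    have hb0 : b ≠ 0 := by rintro rfl; simp at hab; exact hz hab
    have h1 := nrm_nonneg a
    have h2 := nrm_nonneg b
    have h3 := mt (nrm_zero a).1 ha0
    have h4 := mt (nrm_zero b).1 hb0
    have h5 := mt (nrm_unit a).1 ha
    have h6 := mt (nrm_unit b).1 hb
    have h7 : z.norm = a.norm * b.norm := by rw [hab, Zsqrtd.norm_mul]
    have h8 : 2 ≤ a.norm := by omega
    have h9 : 2 ≤ b.norm := by omega
    have hza : a.norm < z.norm := by nlinarith
    have hzb : b.norm < z.norm := by nlinarith
    obtain ⟨l, hl, hl'⟩ := ih a.norm.toNat (by omega) a rfl ha0 ha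
    obtain ⟨m, hm, hm'⟩ := ih b.norm.toNat (by omega) b rfl hb0 hb
    refine ⟨l + m, ?_, by rw [Multiset.prod_add, hl', hm', hab]⟩
    intro p hp
    rcases Multiset.mem_add.1 hp with h | h
    · exact hl p h
    · exact hm p h

lemma round_ex (u n : ℤ) (hn : 0 < n) : ∃ q : ℤ, 2 * (u - q * n) ≤ n ∧ -n ≤ 2 * (u - q * n) := by
  refine ⟨(2 * u + n) / (2 * n), ?_⟩
  have h1 := Int.emod_add_mul_ediv (2 * u + n) (2 * n)
  have h2 := Int.emod_nonneg (2 * u + n) (b := 2 * n) (by omega)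
  have h3 := Int.emod_lt_of_pos (2 * u + n) (b := 2 * n) (by omega)
  constructor <;> nlinarith

lemma division (a b : Zsqrtd (-3)) (hb : b ≠ 0) :
    ∃ q, (a - q * b).norm ≤ b.norm ∧ (b.norm % 2 = 1 → (a - q * b).norm < b.norm) := by
  have hn : 0 < b.norm := lt_of_le_of_ne (nrm_nonneg b) (Ne.symm (mt (nrm_zero b).1 hb))
  obtain ⟨q1, h1, h2⟩ := round_ex (a * star b).re b.norm hn
  obtain ⟨q2, h3, h4⟩ := round_ex (a * star b).im b.norm hn
  refine ⟨⟨q1, q2⟩, ?_⟩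
  set r := a - ⟨q1, q2⟩ * b with hr
  have key : r.norm * b.norm = ((a * star b).re - q1 * b.norm) ^ 2
      + 3 * ((a * star b).im - q2 * b.norm) ^ 2 := by
    simp only [hr, nrm, Zsqrtd.re_mul, Zsqrtd.im_mul, Zsqrtd.re_star, Zsqrtd.im_star,
      Zsqrtd.re_sub, Zsqrtd.im_sub]
    ring
  set u := (a * star b).re - q1 * b.norm
  set v := (a * star b).im - q2 * b.norm
  set n := b.norm
  have hv : 4 * v ^ 2 ≤ n ^ 2 := by nlinarith
  have hu : 4 * u ^ 2 ≤ n ^ 2 := by nlinarith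
  constructor
  · nlinarith
  · intro ho
    have h5 : 2 * u < n := by omega
    have h6 : -n < 2 * u := by omega
    have hu' : 4 * u ^ 2 < n ^ 2 := by nlinarith
    nlinarith

/-- Odd irreducibles are prime. -/
lemma odd_prime (p : Zsqrtd (-3)) (hp : Irreducible p) (ho : p.norm % 2 = 1)
    (x y : Zsqrtd (-3)) (h : p ∣ x * y) : p ∣ x ∨ p ∣ y := by
  classical
  let I : Ideal (Zsqrtd (-3)) := Ideal.span {p, x}
  have hpI : p ∈ I := Ideal.subset_span (by simp)
  have hxI : x ∈ I := Ideal.subset_span (by simp)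
  have hex : ∃ n : ℕ, ∃ b ∈ I, b.norm % 2 = 1 ∧ b.norm.toNat = n := ⟨_, p, hpI, ho, rfl⟩
  obtain ⟨b, hbI, hbo, hbn⟩ := Nat.find_spec hex
  have hmin : ∀ c ∈ I, c.norm % 2 = 1 → b.norm ≤ c.norm := by
    intro c hc hco
    have := Nat.find_min' hex ⟨c, hc, hco, rfl⟩
    have h1 := nrm_nonneg b
    have h2 := nrm_nonneg c
    omega
  have hb0 : b ≠ 0 := by rintro rfl; simp at hbo
  have hdiv : ∀ c ∈ I, b ∣ c := by
    intro c hc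
    obtain ⟨q, -, hq⟩ := division c b hb0
    have hlt := hq hbo
    have hrI : c - q * b ∈ I := I.sub_mem hc (I.mul_mem_left q hbI)
    by_cases hr0 : c - q * b = 0
    · exact ⟨q, by linear_combination hr0⟩
    exfalso
    generalize c - q * b = r at *
    by_cases hro : r.norm % 2 = 1
    · have := hmin r hrI hro; omega
    obtain ⟨s, hs, -⟩ := division b r hr0
    have hsI : b - s * r ∈ I := I.sub_mem hbI (I.mul_mem_left s hrI)
    have hso : (b - s * r).norm % 2 = 1 := by
      have e1 := nrm_parity (b - s * r)
      have e2 := nrm_parity b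
      have e3 := nrm_parity (s * r)
      have e4 : (s * r).norm % 2 = 0 := by
        rw [Zsqrtd.norm_mul, Int.mul_emod]
        have : r.norm % 2 = 0 := by omega
        simp [this]
      rw [Zsqrtd.re_sub, Zsqrtd.im_sub] at e1
      omega
    have := hmin _ hsI hso
    omega
  obtain ⟨c, hc⟩ := hdiv p hpI
  rcases hp.isUnit_or_isUnit hc with hu | hu
  · right
    have h1 : (1 : Zsqrtd (-3)) ∈ I := by
      have := I.eq_top_of_isUnit_mem hbI hu
      rw [this]; trivial
    obtain ⟨s, t, hst⟩ := Ideal.mem_span_pair.1 h1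
    obtain ⟨k, hk⟩ := h
    exact ⟨s * y + t * k, by linear_combination (-y) * hst + t * hk⟩
  · left
    have h1 := hdiv x hxI
    have : p ∣ b := by
      obtain ⟨u, rfl⟩ := hu
      exact ⟨(↑u⁻¹ : Zsqrtd (-3)), by rw [hc, mul_assoc, Units.mul_inv, mul_one]⟩
    exact this.trans h1

lemma irr_of_norm_four (p : Zsqrtd (-3)) (h : p.norm = 4) : Irreducible p := by
  rw [irreducible_iff]
  refine ⟨fun hu => by rw [(nrm_unit p).2 hu] at h; omega, ?_⟩
  intro a b hab
  rw [← nrm_unit, ← nrm_unit]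
  have h1 : a.norm * b.norm = 4 := by rw [← Zsqrtd.norm_mul, ← hab, h]
  have h2 : a.norm ≠ 2 := by
    intro h2
    rw [nrm] at h2
    have i1 : a.im = 0 := by
      have : a.im < 1 := by nlinarith
      have : -1 < a.im := by nlinarith
      omega
    rw [i1] at h2
    have : a.re < 2 := by nlinarith
    have : -2 < a.re := by nlinarith
    have : a.re = -1 ∨ a.re = 0 ∨ a.re = 1 := by omega
    rcases this with h | h | h <;> rw [h] at h2 <;> omega
  have h3 := nrm_nonneg a
  have h4 := nrm_nonneg b
  have h5 : a.norm ≤ 4 := Int.le_of_dvd (by norm_num) ⟨_, h1.symm⟩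
  generalize a.norm = m at *
  interval_cases m <;> omega

lemma unit_eq (c : Zsqrtd (-3)) (h : IsUnit c) : c = 1 ∨ c = -1 := by
  rw [← nrm_unit, nrm] at h
  have i1 : c.im = 0 := by
    have : c.im < 1 := by nlinarith
    have : -1 < c.im := by nlinarith
    omega
  rw [i1] at h
  have : (c.re - 1) * (c.re + 1) = 0 := by linarith
  rcases mul_eq_zero.1 this with h | h
  · left; ext <;> simp <;> omega
  · right; ext <;> simp <;> omega

/-- An even element is divisible by `2` or `1 ± √-3`. -/
lemma even_dvd (w : Zsqrtd (-3)) (h : (w.re + w.im) % 2 = 0) :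
    (∃ c, w = ⟨2, 0⟩ * c) ∨ (∃ c, w = ⟨1, 1⟩ * c) ∨ (∃ c, w = ⟨1, -1⟩ * c) := by
  by_cases h0 : w.re % 2 = 0
  · left
    refine ⟨⟨w.re / 2, w.im / 2⟩, ?_⟩
    ext <;> simp <;> omega
  · right
    by_cases h1 : (w.re - w.im) % 4 = 0
    · left
      refine ⟨⟨(w.re + 3 * w.im) / 4, (w.im - w.re) / 4⟩, ?_⟩
      ext <;> simp <;> omega
    · right
      refine ⟨⟨(w.re - 3 * w.im) / 4, (w.im + w.re) / 4⟩, ?_⟩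
      ext <;> simp <;> omega

lemma even_irr (p : Zsqrtd (-3)) (hp : Irreducible p) (he : p.norm % 2 ≠ 1) :
    ∃ e : Zsqrtd (-3), e * e = 1 ∧ (p = ⟨2, 0⟩ * e ∨ p = ⟨1, 1⟩ * e ∨ p = ⟨1, -1⟩ * e) := by
  have hpar := nrm_parity p
  have aux : ∀ t : Zsqrtd (-3), t.norm = 4 → ∀ c, p = t * c → c * c = 1 := by
    intro t ht c hc
    rcases hp.isUnit_or_isUnit hc with h | h
    · rw [← nrm_unit, ht] at h; omega
    · rcases unit_eq c h with rfl | rfl <;> norm_num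
  rcases even_dvd p (by omega) with ⟨c, hc⟩ | ⟨c, hc⟩ | ⟨c, hc⟩
  · exact ⟨c, aux _ (by simp [nrm]) c hc, Or.inl hc⟩
  · exact ⟨c, aux _ (by simp [nrm]) c hc, Or.inr (Or.inl hc)⟩
  · exact ⟨c, aux _ (by simp [nrm]) c hc, Or.inr (Or.inr hc)⟩

/-- `m` is one of `4`, `2(1 ± √-3)`. -/
def IsM (m : Zsqrtd (-3)) : Prop := m = ⟨4, 0⟩ ∨ m = ⟨2, 2⟩ ∨ m = ⟨2, -2⟩

lemma compl (p m : Zsqrtd (-3)) (hp : Irreducible p) (he : p.norm % 2 ≠ 1) (hm : IsM m) :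
    ∃ p', Irreducible p' ∧ p * p' = m := by
  obtain ⟨e, hee, h⟩ := even_irr p hp he
  have he1 : e.norm = 1 := (nrm_unit e).2 (IsUnit.of_mul_eq_one e hee)
  have aux : ∀ t s : Zsqrtd (-3), p = t * e → s.norm = 4 → t * s = m →
      ∃ p', Irreducible p' ∧ p * p' = m := by
    intro t s ht hs hts
    refine ⟨s * e, irr_of_norm_four _ (by rw [Zsqrtd.norm_mul, hs, he1]; rfl), ?_⟩
    rw [ht]; linear_combination (t * s) * hee + hts
  rcases h with h | h | h <;> rcases hm with rfl | rfl | rfl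
  · exact aux _ ⟨2, 0⟩ h (by simp [nrm]) (by ext <;> simp)
  · exact aux _ ⟨1, 1⟩ h (by simp [nrm]) (by ext <;> simp)
  · exact aux _ ⟨1, -1⟩ h (by simp [nrm]) (by ext <;> simp)
  · exact aux _ ⟨1, -1⟩ h (by simp [nrm]) (by ext <;> simp)
  · exact aux _ ⟨2, 0⟩ h (by simp [nrm]) (by ext <;> simp)
  · exact aux _ ⟨-1, -1⟩ h (by simp [nrm]) (by ext <;> simp)
  · exact aux _ ⟨1, 1⟩ h (by simp [nrm]) (by ext <;> simp)
  · exact aux _ ⟨-1, 1⟩ h (by simp [nrm]) (by ext <;> simp)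
  · exact aux _ ⟨2, 0⟩ h (by simp [nrm]) (by ext <;> simp)

lemma exists_m (z : Zsqrtd (-3)) (h1 : z.re % 2 = 0) (h2 : z.im % 2 = 0)
    (h3 : (z.re + z.im) % 4 = 0) : ∃ m, IsM m ∧ m ∣ z := by
  have hz : z = ⟨2, 0⟩ * ⟨z.re / 2, z.im / 2⟩ := by ext <;> simp <;> omega
  have t1 : (⟨2, 0⟩ * ⟨2, 0⟩ : Zsqrtd (-3)) = ⟨4, 0⟩ := by ext <;> simp
  have t2 : (⟨2, 0⟩ * ⟨1, 1⟩ : Zsqrtd (-3)) = ⟨2, 2⟩ := by ext <;> simp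
  have t3 : (⟨2, 0⟩ * ⟨1, -1⟩ : Zsqrtd (-3)) = ⟨2, -2⟩ := by ext <;> simp
  rcases even_dvd ⟨z.re / 2, z.im / 2⟩ (by simp only; omega) with ⟨c, hc⟩ | ⟨c, hc⟩ | ⟨c, hc⟩
  · exact ⟨_, Or.inl rfl, c, by rw [hz, hc, ← mul_assoc, t1]⟩
  · exact ⟨_, Or.inr (Or.inl rfl), c, by rw [hz, hc, ← mul_assoc, t2]⟩
  · exact ⟨_, Or.inr (Or.inr rfl), c, by rw [hz, hc, ← mul_assoc, t3]⟩

lemma even_pair (z p q : Zsqrtd (-3)) (hp : Irreducible p) (hq : Irreducible q)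
    (hpe : p.norm % 2 ≠ 1) (hqe : q.norm % 2 ≠ 1) (hpz : p ∣ z) (hqz : q ∣ z)
    (hpq : ¬ Associated p q) : ∃ m, IsM m ∧ m ∣ z := by
  obtain ⟨e, hee, h⟩ := even_irr p hp hpe
  obtain ⟨f, hff, h'⟩ := even_irr q hq hqe
  have aux : ∀ t : Zsqrtd (-3), p = t * e → q = t * f → False := by
    intro t h1 h2
    refine hpq ⟨⟨e * f, e * f, ?_, ?_⟩, ?_⟩
    · linear_combination f * f * hee + hff
    · linear_combination f * f * hee + hff
    · simp only [h1, h2]; linear_combination t * f * hee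
  obtain ⟨a, ha⟩ := hpz
  obtain ⟨b, hb⟩ := hqz
  rcases h with h | h | h <;> rcases h' with h' | h' | h' <;>
  first
  | exact (aux _ h h').elim
  | (rw [h, mul_assoc] at ha
     rw [h', mul_assoc] at hb
     generalize e * a = a at *
     generalize f * b = b at *
     have a1 := congrArg Zsqrtd.re ha
     have a2 := congrArg Zsqrtd.im ha
     have b1 := congrArg Zsqrtd.re hb
     have b2 := congrArg Zsqrtd.im hb
     simp only [Zsqrtd.re_mul, Zsqrtd.im_mul] at a1 a2 b1 b2
     apply exists_m <;> omega)

end ZNegThree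

open ZNegThree

/-- `ℤ[√-3]` is an IDPD (Theorem 2.7). -/
theorem zsqrtd_neg_three_isIDPD : IsIDPD (Zsqrtd (-3)) := by
  refine ⟨dom, atomic, ?_⟩
  intro z p q _ _ hp hq hpz hqz hpq
  have := dom
  by_cases hpo : p.norm % 2 = 1
  · refine ⟨q, p, hq, hp, Associated.of_eq (mul_comm p q), ?_⟩
    obtain ⟨c, rfl⟩ := hqz
    rcases odd_prime p hp hpo q c hpz with h | h
    · exact (hpq (hp.associated_of_dvd hq h)).elim
    · exact mul_dvd_mul_left q h
  by_cases hqo : q.norm % 2 = 1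
  · refine ⟨q, p, hq, hp, Associated.of_eq (mul_comm p q), ?_⟩
    obtain ⟨c, rfl⟩ := hpz
    rcases odd_prime q hq hqo p c hqz with h | h
    · exact (hpq (hq.associated_of_dvd hp h).symm).elim
    · rw [mul_comm q p]; exact mul_dvd_mul_left p h
  obtain ⟨m, hm, hmz⟩ := even_pair z p q hp hq hpo hqo hpz hqz hpq
  obtain ⟨p', hp', h1⟩ := compl p m hp hpo hm
  obtain ⟨q', hq', h2⟩ := compl q m hq hqo hm
  exact ⟨p', q', hp', hq', Associated.of_eq (h1.trans h2.symm), by rw [h2]; exact hmz⟩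
end

section
/- Let D be an atomic integral domain and let U be the saturated multiplicatively closed subset of D generated by a set of prime elements of D (i.e., U is saturated and every element of U is a unit multiple of a finite product of prime elements of D). If the localization U⁻¹D is an IDPD, then D is an IDPD. -/
namespace IDPDAux

/-- `a` has no part in `U`: elements of `U` can be cancelled past `a`. -/
def UFree {D : Type*} [CommRing D] (U : Submonoid D) (a : D) : Prop :=
  ∀ s ∈ U, ∀ y, s ∣ a * y → s ∣ y

theorem UFree.mul {D : Type*} [CommRing D] {U : Submonoid D} {a b : D}
    (ha : UFree U a) (hb : UFree U b) : UFree U (a * b) := by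
  intro s hs y h
  rw [mul_assoc] at h
  exact hb s hs y (ha s hs _ h)

theorem primal_of_list {D : Type*} [CommRing D] [IsDomain D] (l : Multiset D)
    (h : ∀ p ∈ l, Prime p) : IsPrimal l.prod := by
  induction l using Multiset.induction_on with
  | empty => simpa using isUnit_one.isPrimal
  | cons a l ih =>
    rw [Multiset.prod_cons]
    exact (h a (by simp)).isPrimal.mul (ih fun p hp => h p (by simp [hp]))

theorem ne_zero_of_list {D : Type*} [CommRing D] [IsDomain D] (l : Multiset D)
    (h : ∀ p ∈ l, Prime p) : l.prod ≠ 0 :=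
  Multiset.prod_ne_zero fun h0 => (h 0 h0).ne_zero rfl

theorem uFree_of_irreducible {D : Type*} [CommRing D] {U : Submonoid D}
    (hsat : ∀ a b : D, a * b ∈ U → a ∈ U ∧ b ∈ U)
    (hprimal : ∀ u ∈ U, IsPrimal u) {x : D} (hx : Irreducible x) (hxU : x ∉ U) :
    UFree U x := by
  intro s hs y h
  obtain ⟨a, b, ⟨c, hc⟩, hb, rfl⟩ := hprimal s hs h
  rcases hx.isUnit_or_isUnit hc with ha | hc'
  · exact ha.mul_left_dvd.2 hb
  · exfalso
    apply hxU
    obtain ⟨w, rfl⟩ := hc'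
    have haU := (hsat _ _ hs).1
    have : x * ((w⁻¹ : Dˣ) : D) = a := by rw [hc]; simp
    exact (hsat _ _ (this ▸ haU)).1

theorem prime_of_primal {D : Type*} [CommRing D] {x : D} (h0 : x ≠ 0)
    (hx : Irreducible x) (h : IsPrimal x) : Prime x := by
  refine ⟨h0, hx.not_isUnit, fun a b hab => ?_⟩
  obtain ⟨c, d, hc, hd, e⟩ := h hab
  rcases hx.isUnit_or_isUnit e with hu | hu
  · right; rw [e]; exact hu.mul_left_dvd.2 hd
  · left; rw [e]; exact hu.mul_right_dvd.2 hc

theorem exists_factor {D L : Type*} [CommRing D] [CommRing L] (f : D →+* L)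
    (l : Multiset D) (h : Irreducible (f l.prod)) :
    ∃ p ∈ l, Associated (f p) (f l.prod) := by
  induction l using Multiset.induction_on with
  | empty => simp at h
  | cons a l ih =>
    have e : f (a ::ₘ l).prod = f a * f l.prod := by simp
    rw [e] at h ⊢
    rcases h.isUnit_or_isUnit rfl with hu | hu
    · have as : Associated (f l.prod) (f a * f l.prod) :=
        (associated_unit_mul_left _ _ hu).symm
      obtain ⟨p, hp, hpa⟩ := ih (as.symm.irreducible h)
      exact ⟨p, by simp [hp], hpa.trans as⟩
    · exact ⟨a, by simp, (associated_mul_unit_left _ _ hu).symm⟩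

end IDPDAux

open IDPDAux

/-- If `U` is a saturated multiplicatively closed set generated by prime elements and
`U⁻¹D` is an IDPD, then `D` is an IDPD (Theorem 2.13). -/
theorem isIDPD_of_localization (D : Type*) [CommRing D] [IsDomain D]
    (hatomic : IsAtomicDomain D) (U : Submonoid D)
    (hsat : ∀ a b : D, a * b ∈ U → a ∈ U ∧ b ∈ U)
    (hgen : ∀ u ∈ U, ∃ (v : D) (l : Multiset D), IsUnit v ∧ (∀ p ∈ l, Prime p) ∧
      u = v * l.prod)
    (hloc : IsIDPD (Localization U)) :
    IsIDPD D := by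
  have hprimal : ∀ u ∈ U, IsPrimal u := by
    intro u hu
    obtain ⟨v, l, hv, hl, rfl⟩ := hgen u hu
    exact hv.isPrimal.mul (primal_of_list l hl)
  have hU0 : U ≤ nonZeroDivisors D := by
    intro u hu
    obtain ⟨v, l, hv, hl, rfl⟩ := hgen u hu
    exact mem_nonZeroDivisors_of_ne_zero (mul_ne_zero hv.ne_zero (ne_zero_of_list l hl))
  obtain ⟨hdom, -, hpair⟩ := hloc
  let f : D →+* Localization U := algebraMap D (Localization U)
  have hinj : Function.Injective f := IsLocalization.injective _ hU0
  have hunit : ∀ s ∈ U, IsUnit (f s) := fun s hs =>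
    IsLocalization.map_units (Localization U) ⟨s, hs⟩
  have hdvd : ∀ a b : D, f a ∣ f b → ∃ s ∈ U, ∃ c, b * s = a * c := by
    rintro a b ⟨X, hX⟩
    obtain ⟨⟨c, s⟩, hc⟩ := IsLocalization.surj U X
    refine ⟨s, s.2, c, hinj ?_⟩
    rw [map_mul, map_mul, hX, mul_assoc]
    exact congrArg _ hc
  have hfree : ∀ a b : D, UFree U a → f a ∣ f b → a ∣ b := by
    intro a b ha h
    obtain ⟨s, hs, c, e⟩ := hdvd a b h
    obtain ⟨d, rfl⟩ := ha s hs c ⟨b, by rw [← e, mul_comm]⟩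
    refine ⟨d, mul_right_cancel₀ (nonZeroDivisors.ne_zero (hU0 hs)) (e.trans (by ring))⟩
  have hmemU : ∀ a : D, IsUnit (f a) → a ∈ U := by
    intro a h
    obtain ⟨s, hs, c, e⟩ := hdvd a 1 h.dvd
    rw [one_mul] at e
    exact (hsat a c (e ▸ hs)).1
  have hirr : ∀ x : D, Irreducible x → x ∉ U → Irreducible (f x) := by
    intro x hx hxU
    refine ⟨fun h => hxU (hmemU x h), ?_⟩
    intro A B hAB
    obtain ⟨⟨a, s⟩, ha⟩ := IsLocalization.surj U A
    obtain ⟨⟨b, t⟩, hb⟩ := IsLocalization.surj U B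
    change A * f s = f a at ha
    change B * f t = f b at hb
    have e : x * ((s : D) * t) = a * b := by
      apply hinj
      simp only [map_mul]
      rw [hAB, ← ha, ← hb]; ring
    have hst : (s : D) * t ∈ U := U.mul_mem s.2 t.2
    obtain ⟨c, d, ⟨a', rfl⟩, ⟨b', rfl⟩, hcd⟩ :=
      hprimal _ hst (Dvd.intro_left x e)
    have hcU := hsat c d (hcd ▸ hst)
    have ex : x = a' * b' := by
      apply mul_right_cancel₀ (nonZeroDivisors.ne_zero (hU0 hst))
      rw [e, hcd]; ring
    rcases hx.isUnit_or_isUnit ex with h | h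
    · left
      have : IsUnit (A * f s) := by
        rw [ha, map_mul]; exact (hunit c hcU.1).mul (h.map f)
      exact isUnit_of_mul_isUnit_left this
    · right
      have : IsUnit (B * f t) := by
        rw [hb, map_mul]; exact (hunit d hcU.2).mul (h.map f)
      exact isUnit_of_mul_isUnit_left this
  have hlift : ∀ X : Localization U, Irreducible X →
      ∃ x : D, Irreducible x ∧ x ∉ U ∧ Associated (f x) X := by
    intro X hX
    obtain ⟨⟨a, s⟩, ha⟩ := IsLocalization.surj U X
    change X * f s = f a at ha
    have has : Associated (f a) X := by
      rw [← ha]; exact associated_mul_unit_left _ _ (hunit s s.2)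
    have hia : Irreducible (f a) := has.symm.irreducible hX
    obtain ⟨l, hl, hla⟩ := hatomic a (fun h => hia.ne_zero (by rw [h, map_zero]))
      (fun h => hia.not_isUnit (h.map f))
    obtain ⟨x, hx, hxa⟩ := exists_factor f l (by rw [hla]; exact hia)
    rw [hla] at hxa
    refine ⟨x, hl x hx, fun h => ?_, hxa.trans has⟩
    exact (hxa.symm.irreducible hia).not_isUnit (hunit x h)
  refine ⟨inferInstance, hatomic, ?_⟩
  have hprime : ∀ z p q : D, Prime p → Irreducible q → p ∣ z → q ∣ z →
      ¬ Associated p q → p * q ∣ z := by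
    rintro z p q hp hq hpz ⟨w, rfl⟩ hn
    rcases hp.dvd_or_dvd hpz with h | ⟨v, rfl⟩
    · exact absurd (hp.irreducible.associated_of_dvd hq h) hn
    · exact ⟨v, by ring⟩
  intro z p q hz hzu hp hq hpz hqz hn
  by_cases hpU : p ∈ U
  · have := hprime z p q (prime_of_primal hp.ne_zero hp (hprimal p hpU)) hq hpz hqz hn
    exact ⟨q, p, hq, hp, by rw [mul_comm], by rwa [mul_comm]⟩
  by_cases hqU : q ∈ U
  · have := hprime z q p (prime_of_primal hq.ne_zero hq (hprimal q hqU)) hp hqz hpz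
      (fun h => hn h.symm)
    exact ⟨q, p, hq, hp, by rw [mul_comm], this⟩
  have F : ∀ x : D, Irreducible x → x ∉ U → UFree U x := fun x hx hxU =>
    uFree_of_irreducible hsat hprimal hx hxU
  have hn' : ¬ Associated (f p) (f q) := fun h =>
    hn (associated_of_dvd_dvd (hfree _ _ (F p hp hpU) h.dvd) (hfree _ _ (F q hq hqU) h.symm.dvd))
  obtain ⟨P, Q, hP, hQ, hPQ, hQz⟩ := hpair (f z) (f p) (f q)
    (fun h => hz (hinj (by rw [h, map_zero])))
    (fun h => (hirr p hp hpU).not_isUnit (isUnit_of_dvd_unit (map_dvd f hpz) h))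
    (hirr p hp hpU) (hirr q hq hqU) (map_dvd f hpz) (map_dvd f hqz) hn'
  obtain ⟨p', hp', hpU', hpP⟩ := hlift P hP
  obtain ⟨q', hq', hqU', hqQ⟩ := hlift Q hQ
  have A1 : Associated (f (p * p')) (f p * P) := by rw [map_mul]; exact hpP.mul_left _
  have A2 : Associated (f (q * q')) (f q * Q) := by rw [map_mul]; exact hqQ.mul_left _
  have A := A1.trans (hPQ.trans A2.symm)
  have F1 := (F p hp hpU).mul (F p' hp' hpU')
  have F2 := (F q hq hqU).mul (F q' hq' hqU')
  exact ⟨p', q', hp', hq', associated_of_dvd_dvd (hfree _ _ F1 A.dvd) (hfree _ _ F2 A.symm.dvd),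
    hfree _ _ F2 (A2.dvd.trans hQz)⟩
end

section
/- Let D be a Dedekind domain such that for every nonzero prime ideal 𝔭 of D, either the class of 𝔭 in the ideal class group of D satisfies [𝔭]² = 1 (i.e., 𝔭² is principal) or there exists a nonzero prime ideal 𝔮 of D with [𝔭]·[𝔮] = 1 (i.e., 𝔭𝔮 is principal). If D is an HFD, then D is an IDPD. -/
open scoped nonZeroDivisors

set_option linter.unusedSectionVars false
set_option linter.overlappingInstances false

namespace IDPDProof

/-- Splitting a product of primes. -/
lemma split_prod {M ι : Type*} [CommMonoidWithZero M] [IsCancelMulZero M]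
    (hu : ∀ u : M, IsUnit u → u = 1)
    (f : ι → M) (s : Multiset ι) :
    (∀ a ∈ s, Prime (f a)) → ∀ x y : M, x * y = (s.map f).prod →
      ∃ t u, s = t + u ∧ x = (t.map f).prod ∧ y = (u.map f).prod := by
  induction s using Multiset.induction_on with
  | empty =>
    intro _ x y hxy
    simp only [Multiset.map_zero, Multiset.prod_zero] at hxy
    refine ⟨0, 0, by simp, ?_, ?_⟩
    · simpa using hu x (IsUnit.of_mul_eq_one _ hxy)
    · simpa using hu y (IsUnit.of_mul_eq_one _ (by rw [mul_comm]; exact hxy))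
  | cons a s ih =>
    intro hp x y hxy
    have ha := hp a (by simp)
    have hs : ∀ b ∈ s, Prime (f b) := fun b hb => hp b (by simp [hb])
    rw [Multiset.map_cons, Multiset.prod_cons] at hxy
    rcases ha.dvd_or_dvd (hxy ▸ dvd_mul_right (f a) _ : f a ∣ x * y) with ⟨c, rfl⟩ | ⟨c, rfl⟩
    · rw [mul_assoc] at hxy
      obtain ⟨t, u, rfl, h1, h2⟩ := ih hs c y (mul_left_cancel₀ ha.ne_zero hxy)
      exact ⟨a ::ₘ t, u, by simp, by simp [h1], h2⟩
    · rw [mul_left_comm] at hxy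
      obtain ⟨t, u, rfl, h1, h2⟩ := ih hs x c (mul_left_cancel₀ ha.ne_zero hxy)
      exact ⟨t, a ::ₘ u, by simp, h1, by simp [h2]⟩

variable {D : Type*} [CommRing D] [IsDomain D] [IsDedekindDomain D]

lemma ideal_unit (u : Ideal D) (hu : IsUnit u) : u = 1 := by
  rwa [Ideal.isUnit_iff, ← Ideal.one_eq_top] at hu

lemma span_prod {ι : Type*} (g : ι → D) (s : Multiset ι) :
    (s.map (fun a => Ideal.span {g a})).prod = Ideal.span {(s.map g).prod} := by
  induction s using Multiset.induction_on with
  | empty => simp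
  | cons a s ih => simp [ih, Ideal.span_singleton_mul_span_singleton]

lemma span_eq_mul {x y : D} {I : Ideal D} (hx : x ≠ 0)
    (h : Ideal.span {x} * I = Ideal.span {y}) : ∃ b, I = Ideal.span {b} := by
  have : Ideal.span {x} ∣ Ideal.span {y} := ⟨I, h.symm⟩
  rw [Ideal.dvd_iff_le, Ideal.span_singleton_le_span_singleton] at this
  obtain ⟨b, rfl⟩ := this
  refine ⟨b, ?_⟩
  rw [← Ideal.span_singleton_mul_span_singleton] at h
  exact mul_left_cancel₀ (by simpa using hx) h

lemma span_isUnit {x : D} : IsUnit (Ideal.span {x}) ↔ IsUnit x := by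
  rw [Ideal.isUnit_iff, Ideal.span_singleton_eq_top]

lemma span_dvd {x y : D} : Ideal.span {x} ∣ Ideal.span {y} ↔ x ∣ y := by
  rw [Ideal.dvd_iff_le, Ideal.span_singleton_le_span_singleton]

lemma card_le_two
    (h : ∀ P : (Ideal D)⁰, (P : Ideal D).IsPrime →
      (ClassGroup.mk0 P) ^ 2 = 1 ∨
        ∃ Q : (Ideal D)⁰, (Q : Ideal D).IsPrime ∧
          ClassGroup.mk0 P * ClassGroup.mk0 Q = 1)
    (hHFD : IsHFD D) (q : D) (hq : Irreducible q) (s : Multiset (Ideal D))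
    (hs : ∀ P ∈ s, Prime P) (hprod : s.prod = Ideal.span {q}) : Multiset.card s ≤ 2 := by
  have hex : ∀ P : Ideal D, ∃ Q : Ideal D, ∃ g : D, Prime P →
      Prime Q ∧ P * Q = Ideal.span {g} := by
    intro P
    by_cases hP : Prime P
    swap
    · exact ⟨1, 0, fun h => absurd h hP⟩
    have hP0 : P ∈ (Ideal D)⁰ := mem_nonZeroDivisors_of_ne_zero hP.ne_zero
    have : ∃ Q : (Ideal D)⁰, (Q : Ideal D).IsPrime ∧
          ClassGroup.mk0 ⟨P, hP0⟩ * ClassGroup.mk0 Q = 1 := by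
      rcases h ⟨P, hP0⟩ (Ideal.isPrime_of_prime hP) with h1 | h1
      · exact ⟨⟨P, hP0⟩, Ideal.isPrime_of_prime hP, by rw [← sq, h1]⟩
      · exact h1
    obtain ⟨Q, hQ, h1⟩ := this
    rw [← map_mul, ClassGroup.mk0_eq_one_iff] at h1
    obtain ⟨g, hg⟩ := h1
    exact ⟨Q, g, fun _ => ⟨Ideal.prime_of_isPrime (nonZeroDivisors.ne_zero Q.2) hQ, hg⟩⟩
  choose f g hfg using hex
  by_cases hpr : ∃ P ∈ s, ∃ a, P = Ideal.span {a}
  · obtain ⟨P, hPs, a, rfl⟩ := hpr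
    obtain ⟨t, rfl⟩ := Multiset.exists_cons_of_mem hPs
    rw [Multiset.prod_cons] at hprod
    have ha := hs _ hPs
    obtain ⟨b, hb⟩ := span_eq_mul (by simpa using ha.ne_zero) hprod
    have hun : IsUnit t.prod := by
      have h2 := hprod
      rw [hb, Ideal.span_singleton_mul_span_singleton, Ideal.span_singleton_eq_span_singleton] at h2
      rcases (h2.irreducible_iff.2 hq).isUnit_or_isUnit rfl with h3 | h3
      · exact absurd (span_isUnit.2 h3) ha.not_isUnit
      · rw [hb]; exact span_isUnit.2 h3
    have : t = 0 := by
      refine Multiset.eq_zero_of_forall_notMem fun P hP => ?_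
      exact (hs P (by simp [hP])).not_isUnit (isUnit_of_dvd_unit (Multiset.dvd_prod hP) hun)
    simp [this]
  · push Not at hpr
    have hsub : ∀ t : Multiset (Ideal D), (∀ P ∈ t, Prime P) →
        t.prod * (t.map f).prod = Ideal.span {(t.map g).prod} := by
      intro t ht
      rw [← span_prod]
      conv_lhs => rw [← Multiset.map_id t, Multiset.map_map]
      rw [← Multiset.prod_map_mul]
      exact congrArg _ (Multiset.map_congr rfl fun P hP => (hfg P (ht P hP)).2)
    have hgirr : ∀ P ∈ s, Irreducible (g P) := by
      intro P hPs
      have hP := hs P hPs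
      obtain ⟨hQ, hPQ⟩ := hfg P hP
      have key : ∀ a b : D, ¬ IsUnit b → g P = a * b → ¬ P ∣ Ideal.span {a} := by
        rintro a b hb hab ⟨c, hc⟩
        rw [hab, ← Ideal.span_singleton_mul_span_singleton, hc, mul_assoc] at hPQ
        have h3 := mul_left_cancel₀ hP.ne_zero hPQ
        rcases hQ.irreducible.isUnit_or_isUnit h3 with h4 | h4
        · rw [ideal_unit c h4, mul_one] at hc
          exact hpr P hPs a hc.symm
        · exact hb (span_isUnit.1 h4)
      refine ⟨fun hu => ?_, fun a b hab => ?_⟩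
      · rw [← span_isUnit, ← hPQ] at hu
        exact hP.not_isUnit (isUnit_of_mul_isUnit_left hu)
      · by_contra! hcon
        have : P ∣ Ideal.span {a} * Ideal.span {b} := by
          rw [Ideal.span_singleton_mul_span_singleton, ← hab, ← hPQ]
          exact dvd_mul_right _ _
        rcases hP.dvd_or_dvd this with h5 | h5
        · exact key a b hcon.2 hab h5
        · exact key b a hcon.1 (by rw [hab, mul_comm]) h5
    have hall := hsub s hs
    rw [hprod] at hall
    obtain ⟨b, hb⟩ := span_eq_mul hq.ne_zero hall
    have hfs : ∀ P ∈ s, Prime (f P) := fun P hP => (hfg P (hs P hP)).1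
    have hzero : ∀ t : Multiset (Ideal D), (∀ P ∈ t, Prime P) → IsUnit t.prod → t = 0 := by
      intro t ht hun
      refine Multiset.eq_zero_of_forall_notMem fun P hP => ?_
      exact (ht P hP).not_isUnit (isUnit_of_dvd_unit (Multiset.dvd_prod hP) hun)
    have hbirr : Irreducible b := by
      constructor
      · intro hbu
        have hs0 : s = 0 := by
          refine Multiset.eq_zero_of_forall_notMem fun P hP => ?_
          refine (hfs P hP).not_isUnit (isUnit_of_dvd_unit
            (Multiset.dvd_prod (Multiset.mem_map_of_mem f hP)) ?_)
          rw [hb]; exact span_isUnit.2 hbu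
        rw [hs0, Multiset.prod_zero] at hprod
        exact hq.not_isUnit (span_isUnit.1 (hprod ▸ isUnit_one))
      · intro x y hxy
        obtain ⟨t, u, rfl, h1, h2⟩ := split_prod ideal_unit f s hfs (Ideal.span {x})
          (Ideal.span {y}) (by rw [hb, Ideal.span_singleton_mul_span_singleton, hxy])
        have ht : ∀ P ∈ t, Prime P := fun P hP => hs P (by simp [hP])
        have hu : ∀ P ∈ u, Prime P := fun P hP => hs P (by simp [hP])
        have hb0 : b ≠ 0 := by
          rintro rfl
          have : ((t + u).map f).prod ≠ 0 := by
            refine Multiset.prod_ne_zero fun h0 => ?_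
            obtain ⟨P, hP, hP0⟩ := Multiset.mem_map.1 h0
            exact (hfs P hP).ne_zero hP0
          exact this (by rw [hb]; simp)
        have e1 := hsub t ht
        have e2 := hsub u hu
        rw [← h1, mul_comm] at e1
        rw [← h2, mul_comm] at e2
        obtain ⟨v, hv⟩ := span_eq_mul (left_ne_zero_of_mul (hxy ▸ hb0)) e1
        obtain ⟨w, hw⟩ := span_eq_mul (right_ne_zero_of_mul (hxy ▸ hb0)) e2
        rw [Multiset.prod_add, hv, hw, Ideal.span_singleton_mul_span_singleton,
          Ideal.span_singleton_eq_span_singleton] at hprod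
        rcases (hprod.irreducible_iff.2 hq).isUnit_or_isUnit rfl with h3 | h3
        · left
          have := hzero t ht (hv ▸ span_isUnit.2 h3)
          rw [this] at h1
          rw [← span_isUnit, h1]; simp
        · right
          have := hzero u hu (hw ▸ span_isUnit.2 h3)
          rw [this] at h2
          rw [← span_isUnit, h2]; simp
    rw [hb, Ideal.span_singleton_mul_span_singleton,
      Ideal.span_singleton_eq_span_singleton] at hall
    obtain ⟨e, he⟩ := hall
    have hbe : Irreducible (b * e) := (irreducible_mul_units e).2 hbirr
    have := hHFD.2.2 {q, b * e} (s.map g) (by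
        intro p hp
        simp only [Multiset.insert_eq_cons, Multiset.mem_cons, Multiset.mem_singleton] at hp
        rcases hp with rfl | rfl
        · exact hq
        · exact hbe) (by
        intro p hp
        obtain ⟨P, hP, rfl⟩ := Multiset.mem_map.1 hp
        exact hgirr P hP) (by
        rw [← he]; simp [mul_assoc])
    simp at this
    omega

end IDPDProof

open IDPDProof in
/-- Zaks-type criterion (Theorem 3.5): a Dedekind domain HFD in which every nonzero
prime ideal class either squares to the identity or has an inverse represented by a
prime ideal is an IDPD. -/
theorem isIDPD_of_prime_classes (D : Type*) [CommRing D] [IsDomain D] [IsDedekindDomain D]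
    (h : ∀ P : (Ideal D)⁰, (P : Ideal D).IsPrime →
      (ClassGroup.mk0 P) ^ 2 = 1 ∨
        ∃ Q : (Ideal D)⁰, (Q : Ideal D).IsPrime ∧
          ClassGroup.mk0 P * ClassGroup.mk0 Q = 1)
    (hHFD : IsHFD D) :
    IsIDPD D := by
  refine ⟨inferInstance, hHFD.2.1, ?_⟩
  rintro z p q hz - hp hq ⟨w, rfl⟩ hqz hpq
  have hw0 : w ≠ 0 := right_ne_zero_of_mul hz
  have hqp : ¬ q ∣ p := fun hd => hpq (hq.associated_of_dvd hp hd).symm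
  -- it suffices to find `p'`
  suffices hmain : ∃ p', Irreducible p' ∧ p' ∣ w ∧ q ∣ p * p' by
    obtain ⟨p', hp', hpw, q', hq'⟩ := hmain
    refine ⟨p', q', hp', ?_, ?_, ?_⟩
    · have h0 : q' ≠ 0 := by
        rintro rfl
        rw [mul_zero] at hq'
        exact mul_ne_zero hp.ne_zero hp'.ne_zero hq'
      have hnu : ¬ IsUnit q' := by
        intro hu
        have : Irreducible (p * p') := by
          rw [hq']; exact (irreducible_mul_isUnit hu).2 hq
        rcases this.isUnit_or_isUnit rfl with h1 | h1
        · exact hp.not_isUnit h1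
        · exact hp'.not_isUnit h1
      obtain ⟨l, hl, hlp⟩ := hHFD.2.1 q' h0 hnu
      have := hHFD.2.2 {p, p'} (q ::ₘ l) (by
        intro x hx
        simp only [Multiset.insert_eq_cons, Multiset.mem_cons, Multiset.mem_singleton] at hx
        rcases hx with rfl | rfl <;> assumption) (by
        intro x hx
        rcases Multiset.mem_cons.1 hx with rfl | hx
        · exact hq
        · exact hl x hx) (by simp [hlp, hq'])
      have hc : Multiset.card l = 1 := by simp at this; omega
      obtain ⟨a, rfl⟩ := Multiset.card_eq_one.1 hc
      rw [← hlp]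
      simpa using hl
    · rw [hq']
    · rw [← hq']; exact mul_dvd_mul_left p hpw
  by_cases hco : ∃ Q : Ideal D, Prime Q ∧ Q ∣ Ideal.span {q} ∧ Q ∣ Ideal.span {p}
  · obtain ⟨Q, hQ, ⟨B, hB⟩, hQp⟩ := hco
    have hq0 : Ideal.span {q} ≠ 0 := by simpa using hq.ne_zero
    have hB0 : B ≠ 0 := by
      rintro rfl
      exact hq0 (by rw [hB, mul_zero])
    obtain ⟨s, hs, hsB⟩ := UniqueFactorizationMonoid.exists_prime_factors B hB0
    have hsB' : s.prod = B := associated_iff_eq.1 hsB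
    have hc := card_le_two h hHFD q hq (Q ::ₘ s) (by
      intro P hP
      rcases Multiset.mem_cons.1 hP with rfl | hP
      · exact hQ
      · exact hs P hP) (by rw [Multiset.prod_cons, hsB', hB])
    rw [Multiset.card_cons] at hc
    have hc' : Multiset.card s = 0 ∨ Multiset.card s = 1 := by omega
    rcases hc' with hc | hc
    · rw [Multiset.card_eq_zero.1 hc, Multiset.prod_zero] at hsB'
      rw [← hsB', mul_one] at hB
      exact absurd (span_dvd.1 (hB ▸ hQp)) hqp
    · obtain ⟨B', rfl⟩ := Multiset.card_eq_one.1 hc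
      rw [Multiset.prod_singleton] at hsB'
      subst hsB'
      have hBp : Prime B' := hs B' (by simp)
      obtain ⟨C, hC⟩ := hQp
      have hd := span_dvd.2 hqz
      rw [← Ideal.span_singleton_mul_span_singleton, hB, hC, mul_assoc,
        mul_dvd_mul_iff_left hQ.ne_zero] at hd
      rcases hBp.dvd_or_dvd hd with h1 | h1
      · refine absurd (span_dvd.1 ?_) hqp
        rw [hB, hC]; exact mul_dvd_mul_left _ h1
      · have hwu : ¬ IsUnit w := fun hu =>
          hBp.not_isUnit (isUnit_of_dvd_unit h1 (span_isUnit.2 hu))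
        obtain ⟨l, hl, rfl⟩ := hHFD.2.1 w hw0 hwu
        have h2 := span_prod (fun x : D => x) l
        rw [Multiset.map_id'] at h2
        rw [← h2] at h1
        obtain ⟨x, hx, hBx⟩ := hBp.exists_mem_multiset_map_dvd h1
        refine ⟨x, hl x hx, Multiset.dvd_prod hx, span_dvd.1 ?_⟩
        rw [← Ideal.span_singleton_mul_span_singleton, hB, hC]
        rw [mul_assoc]
        exact mul_dvd_mul_left Q (dvd_mul_of_dvd_right hBx C)
  · refine ⟨q, hq, ?_, dvd_mul_left _ _⟩
    have hd := span_dvd.2 hqz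
    rw [← Ideal.span_singleton_mul_span_singleton] at hd
    refine span_dvd.1 (UniqueFactorizationMonoid.dvd_of_dvd_mul_right_of_no_prime_factors
      (by simpa using hq.ne_zero) ?_ hd)
    intro d h1 h2 h3
    exact hco ⟨d, h3, h1, h2⟩
end

section
/- Let D be a Dedekind domain whose ideal class group is an elementary abelian 2-group, i.e., g² = 1 for every g ∈ ClassGroup D. If D is an HFD, then D is an IDPD. -/
theorem idpd_sq_principal {D : Type*} [CommRing D] [IsDomain D] [IsDedekindDomain D]
    (h : ∀ g : ClassGroup D, g ^ 2 = 1) (Q : Ideal D) (hQ : Q ≠ ⊥) :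
    ∃ a : D, Q * Q = Ideal.span {a} := by
  have h1 := h (ClassGroup.mk0 ⟨Q, mem_nonZeroDivisors_iff_ne_zero.mpr hQ⟩)
  rw [← map_pow, ClassGroup.mk0_eq_one_iff] at h1
  obtain ⟨a, ha⟩ := h1.principal
  refine ⟨a, ?_⟩
  have : ((⟨Q, mem_nonZeroDivisors_iff_ne_zero.mpr hQ⟩ ^ 2 : nonZeroDivisors (Ideal D)) : Ideal D)
      = Q * Q := by
    simp [pow_two]
  rw [← this]
  exact ha

theorem idpd_span_dvd {D : Type*} [CommRing D] [IsDomain D] [IsDedekindDomain D] (a b : D) :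
    Ideal.span {a} ∣ Ideal.span {b} ↔ a ∣ b := by
  rw [Ideal.dvd_span_singleton, Ideal.mem_span_singleton]

theorem idpd_irr {D : Type*} [CommRing D] [IsDomain D] [IsDedekindDomain D]
    (Q : Ideal D) (hQ : Prime Q) (hn : ∀ b : D, Q ≠ Ideal.span {b}) (a : D)
    (ha : Q * Q = Ideal.span {a}) : Irreducible a := by
  refine ⟨fun hu => ?_, fun b c hbc => ?_⟩
  · rw [Ideal.span_singleton_eq_top.mpr hu] at ha
    apply hQ.not_unit
    exact IsUnit.of_mul_eq_one Q (by rw [ha, Ideal.one_eq_top])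
  · rw [hbc, ← Ideal.span_singleton_mul_span_singleton] at ha
    have hd : Ideal.span {b} ∣ Q ^ 2 := ⟨_, by rw [pow_two, ha]⟩
    obtain ⟨i, hi, hb⟩ := (dvd_prime_pow hQ 2).mp hd
    rw [associated_iff_eq] at hb
    interval_cases i
    · left
      rw [pow_zero, Ideal.one_eq_top] at hb
      exact Ideal.span_singleton_eq_top.mp hb
    · rw [pow_one] at hb
      exact absurd hb.symm (hn b)
    · right
      rw [hb, ← pow_two] at ha
      have h2 : Q ^ 2 ≠ 0 := pow_ne_zero _ hQ.ne_zero
      have : Q ^ 2 * Ideal.span {c} = Q ^ 2 * 1 := by rw [mul_one]; exact ha.symm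
      have := mul_left_cancel₀ h2 this
      rw [Ideal.one_eq_top] at this
      exact Ideal.span_singleton_eq_top.mp this

theorem idpd_struct {D : Type*} [CommRing D] [IsDomain D] [IsDedekindDomain D]
    (h : ∀ g : ClassGroup D, g ^ 2 = 1) (hHFD : IsHFD D) (q : D) (hq : Irreducible q) :
    Prime q ∨ ∃ A B : Ideal D, Prime A ∧ Prime B ∧ A * B = Ideal.span {q} := by
  classical
  have hq0 : Ideal.span {q} ≠ (0 : Ideal D) := by
    simpa using hq.ne_zero
  obtain ⟨s, hs, hsq⟩ := UniqueFactorizationMonoid.exists_prime_factors (Ideal.span {q}) hq0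
  rw [associated_iff_eq] at hsq
  by_cases hp : ∃ Q ∈ s, ∃ b : D, Q = Ideal.span {b}
  · left
    obtain ⟨Q, hQs, b, rfl⟩ := hp
    have hP := hs _ hQs
    have hd : Ideal.span {b} ∣ Ideal.span {q} := hsq ▸ Multiset.dvd_prod hQs
    rw [idpd_span_dvd] at hd
    have hb0 : b ≠ 0 := by
      rintro rfl
      exact hP.ne_zero (by simp)
    have hb : Prime b := by
      rw [← Ideal.span_singleton_prime hb0]
      exact Ideal.isPrime_of_prime hP
    exact ((hb.irreducible.associated_of_dvd hq hd).prime_iff).mp hb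
  · right
    push Not at hp
    choose! f hf using fun (Q : Ideal D) (hQ : Q ≠ ⊥) => idpd_sq_principal h Q hQ
    have hf' : ∀ Q ∈ s, Q * Q = Ideal.span {f Q} := fun Q hQ => hf Q (hs Q hQ).ne_zero
    have hprod : ∀ t : Multiset (Ideal D), (∀ Q ∈ t, Q * Q = Ideal.span {f Q}) →
        Ideal.span {(t.map f).prod} = t.prod * t.prod := by
      intro t
      induction t using Multiset.induction_on with
      | empty => intro _; simp
      | cons Q t ih =>
        intro ht
        rw [Multiset.map_cons, Multiset.prod_cons, Multiset.prod_cons,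
          ← Ideal.span_singleton_mul_span_singleton, ih fun R hR => ht R (Multiset.mem_cons_of_mem hR),
          ← ht Q (Multiset.mem_cons_self _ _)]
        ring
    have h1 := hprod s hf'
    rw [hsq, Ideal.span_singleton_mul_span_singleton, Ideal.span_singleton_eq_span_singleton] at h1
    obtain ⟨u, hu⟩ := h1.symm
    have hc := hHFD.2.2 {q, q * u} (s.map f) (by
      intro p hp
      simp only [Multiset.insert_eq_cons, Multiset.mem_cons, Multiset.mem_singleton] at hp
      rcases hp with rfl | rfl
      · exact hq
      · exact (irreducible_mul_units u).mpr hq) (by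
      intro p hp'
      obtain ⟨Q, hQ, rfl⟩ := Multiset.mem_map.mp hp'
      exact idpd_irr Q (hs Q hQ) (hp Q hQ) _ (hf' Q hQ)) (by
      simp [← hu, mul_assoc])
    rw [Multiset.card_map] at hc
    obtain ⟨A, B, rfl⟩ := Multiset.card_eq_two.mp (hc.symm.trans (by simp))
    exact ⟨A, B, hs A (by simp), hs B (by simp), by simpa using hsq⟩

theorem idpd_half {D : Type*} [CommRing D] [IsDomain D] [IsDedekindDomain D]
    (hA : IsAtomicDomain D) (p q w : D) (hw : w ≠ 0) (hqp : ¬ q ∣ p) (A B : Ideal D)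
    (hB : Prime B) (hAB : A * B = Ideal.span {q}) (hq0 : q ≠ 0)
    (hd : q ∣ p * w) (hAp : A ∣ Ideal.span {p}) :
    ∃ p' : D, Irreducible p' ∧ p' ∣ w ∧ q ∣ p * p' := by
  obtain ⟨P, hP⟩ := hAp
  have hA0 : A ≠ 0 := by
    rintro rfl
    rw [zero_mul] at hAB
    exact hq0 (Ideal.span_singleton_eq_bot.mp hAB.symm)
  have h1 := (idpd_span_dvd _ _).mpr hd
  rw [← Ideal.span_singleton_mul_span_singleton, ← hAB, hP, mul_assoc,
    mul_dvd_mul_iff_left hA0] at h1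
  rcases hB.dvd_or_dvd h1 with h2 | h2
  · exact absurd ((idpd_span_dvd _ _).mp (hAB ▸ hP ▸ mul_dvd_mul_left A h2)) hqp
  · have hwu : ¬ IsUnit w := by
      intro hu
      rw [Ideal.span_singleton_eq_top.mpr hu, ← Ideal.one_eq_top] at h2
      exact hB.not_unit (isUnit_of_dvd_one h2)
    obtain ⟨l, hl, rfl⟩ := hA w hw hwu
    have hBp : B.IsPrime := Ideal.isPrime_of_prime hB
    rw [Ideal.dvd_span_singleton] at h2
    obtain ⟨x, hx, hxB⟩ := (hBp.multiset_prod_mem_iff_exists_mem l).mp h2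
    refine ⟨x, hl x hx, Multiset.dvd_prod hx, ?_⟩
    rw [← idpd_span_dvd, ← Ideal.span_singleton_mul_span_singleton, ← hAB]
    exact mul_dvd_mul ⟨P, hP⟩ (Ideal.dvd_span_singleton.mpr hxB)

/-- A Dedekind domain HFD whose class group is an elementary abelian 2-group is an
IDPD (Corollary 3.6). -/
theorem isIDPD_of_elementary_two_group (D : Type*) [CommRing D] [IsDomain D]
    [IsDedekindDomain D]
    (h : ∀ g : ClassGroup D, g ^ 2 = 1)
    (hHFD : IsHFD D) :
    IsIDPD D := by
  refine ⟨inferInstance, hHFD.2.1, ?_⟩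
  rintro z p q hz - hp hq ⟨w, rfl⟩ hqz hpq
  have hw : w ≠ 0 := right_ne_zero_of_mul hz
  have hqp : ¬ q ∣ p := fun hd => hpq (hq.associated_of_dvd hp hd).symm
  have key : ∃ p' : D, Irreducible p' ∧ p' ∣ w ∧ q ∣ p * p' := by
    by_cases hqw : q ∣ w
    · exact ⟨q, hq, hqw, dvd_mul_left _ _⟩
    rcases idpd_struct h hHFD q hq with hqP | ⟨A, B, hA, hB, hAB⟩
    · exact absurd hqz (by rintro hd; exact (hqP.dvd_or_dvd hd).elim hqp hqw)
    by_cases hAp : A ∣ Ideal.span {p}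
    · exact idpd_half hHFD.2.1 p q w hw hqp A B hB hAB hq.ne_zero hqz hAp
    by_cases hBp : B ∣ Ideal.span {p}
    · exact idpd_half hHFD.2.1 p q w hw hqp B A hA (by rw [mul_comm, hAB]) hq.ne_zero hqz hBp
    exfalso
    apply hqw
    have h1 := (idpd_span_dvd _ _).mpr hqz
    rw [← Ideal.span_singleton_mul_span_singleton, ← hAB] at h1
    rw [← idpd_span_dvd, ← hAB]
    obtain ⟨W, hW⟩ := (hA.dvd_or_dvd ((dvd_mul_right A B).trans h1)).resolve_left hAp
    rw [hW, mul_left_comm, mul_dvd_mul_iff_left hA.ne_zero] at h1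
    rw [hW]
    exact mul_dvd_mul_left A ((hB.dvd_or_dvd h1).resolve_left hBp)
  obtain ⟨p', hp', hpw, q', hq'⟩ := key
  have hq'0 : q' ≠ 0 := by
    rintro rfl
    rw [mul_zero] at hq'
    exact mul_ne_zero hp.ne_zero hp'.ne_zero hq'
  refine ⟨p', q', hp', ?_, hq' ▸ Associated.refl _, hq' ▸ mul_dvd_mul_left p hpw⟩
  have hu : ¬ IsUnit q' := by
    intro hu
    have : Irreducible (p * p') := hq' ▸ (irreducible_mul_isUnit hu).mpr hq
    exact (this.isUnit_or_isUnit rfl).elim hp.not_isUnit hp'.not_isUnit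
  obtain ⟨l, hl, hlq⟩ := hHFD.2.1 q' hq'0 hu
  have hc := hHFD.2.2 {p, p'} (q ::ₘ l) (by
    intro x hx
    simp only [Multiset.insert_eq_cons, Multiset.mem_cons, Multiset.mem_singleton] at hx
    rcases hx with rfl | rfl <;> assumption) (by
    intro x hx
    rcases Multiset.mem_cons.mp hx with rfl | hx
    · exact hq
    · exact hl x hx) (by simp [hlq, hq'])
  have hc1 : Multiset.card l = 1 := by simpa using hc.symm
  obtain ⟨x, rfl⟩ := Multiset.card_eq_one.mp hc1
  rw [Multiset.prod_singleton] at hlq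
  exact hlq ▸ hl x (by simp)
end

section
/- Let p be a prime number and let D be a Dedekind domain whose ideal class group ClassGroup D is isomorphic either to the cyclic group ℤ/p^kℤ for some k ≥ 1, or to the Prüfer p-group ℤ_{p^∞} (the p-primary torsion subgroup of ℚ/ℤ). If D is an HFD, then D is an IDPD. -/
/-- The Prüfer `p`-group `ℤ(p^∞)`: the `p`-primary torsion subgroup of `ℚ/ℤ`. -/
def PruferGroup (p : ℕ) [Fact p.Prime] : AddSubgroup (AddCircle (1 : ℚ)) :=
  AddCommGroup.primaryComponent (AddCircle (1 : ℚ)) p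


namespace IDPDProof

lemma group_prufer (p : ℕ) [Fact p.Prime] :
    (∀ g : Multiplicative (PruferGroup p), ∃ k, orderOf g = p ^ k) ∧
    (∀ g h : Multiplicative (PruferGroup p), orderOf h ∣ orderOf g →
      h ∈ Subgroup.zpowers g) := by
  have hk : ∀ g : PruferGroup p, ∃ k, addOrderOf g = p ^ k := by
    intro g
    obtain ⟨k, hk⟩ : ∃ k : ℕ, p ^ k • (g : AddCircle (1 : ℚ)) = 0 := g.2
    have hd : addOrderOf (g : AddCircle (1 : ℚ)) ∣ p ^ k := addOrderOf_dvd_of_nsmul_eq_zero hk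
    obtain ⟨j, -, hj⟩ := (Nat.dvd_prime_pow (Fact.out : p.Prime)).1 hd
    exact ⟨j, by rw [← hj, AddSubgroup.addOrderOf_coe]⟩
  refine ⟨fun g => ?_, fun g h hd => ?_⟩
  · obtain ⟨k, hk⟩ := hk g.toAdd
    exact ⟨k, by rw [← hk, ← orderOf_ofAdd_eq_addOrderOf]; rfl⟩
  · have hgp : 0 < addOrderOf g.toAdd := by
      obtain ⟨k, hk⟩ := hk g.toAdd
      rw [hk]; exact pow_pos (Fact.out : p.Prime).pos _
    have hhp : 0 < addOrderOf h.toAdd := by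
      obtain ⟨k, hk⟩ := hk h.toAdd
      rw [hk]; exact pow_pos (Fact.out : p.Prime).pos _
    have hd' : addOrderOf h.toAdd ∣ addOrderOf g.toAdd := by
      rw [← orderOf_ofAdd_eq_addOrderOf, ← orderOf_ofAdd_eq_addOrderOf]; exact hd
    set n := addOrderOf g.toAdd with hn
    set d := addOrderOf h.toAdd with hdd
    have : Fact ((0 : ℚ) < 1) := ⟨one_pos⟩
    have hg2 : addOrderOf (g.toAdd : AddCircle (1 : ℚ)) = n := by
      rw [hn, AddSubgroup.addOrderOf_coe]
    have hh2 : addOrderOf (h.toAdd : AddCircle (1 : ℚ)) = d := by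
      rw [hdd, AddSubgroup.addOrderOf_coe]
    obtain ⟨u, -, hu, hgu⟩ := (AddCircle.addOrderOf_eq_pos_iff hgp).1 hg2
    obtain ⟨v, -, -, hhv⟩ := (AddCircle.addOrderOf_eq_pos_iff hhp).1 hh2
    obtain ⟨e, he⟩ := hd'
    have hbez : (u : ℤ) * u.gcdA n + n * u.gcdB n = 1 := by
      rw [← Nat.gcd_eq_gcd_ab, hu]; rfl
    rw [Subgroup.mem_zpowers_iff]
    refine ⟨u.gcdA n * (v * e), ?_⟩
    apply Multiplicative.toAdd.injective
    rw [toAdd_zpow]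
    apply Subtype.ext
    rw [AddSubgroup.coe_zsmul, ← hgu, ← hhv, ← AddCircle.coe_zsmul]
    rw [← sub_eq_zero, ← AddCircle.coe_sub, AddCircle.coe_eq_zero_iff]
    refine ⟨- (u.gcdB n * (v * e)), ?_⟩
    have hb : (u : ℚ) * u.gcdA n + n * u.gcdB n = 1 := by exact_mod_cast hbez
    have heq : (n : ℚ) = d * e := by exact_mod_cast he
    have hn0 : (n : ℚ) ≠ 0 := by positivity
    have hd0 : (d : ℚ) ≠ 0 := by positivity
    have : (v : ℚ) / d = v * e / n := by 
      rw [heq] at hn0 ⊢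
      have he0 : (e : ℚ) ≠ 0 := right_ne_zero_of_mul hn0
      field_simp
    rw [this]
    push_cast [zsmul_eq_mul]
    field_simp
    linear_combination (-(v : ℚ) * e) * hb

lemma group_zmod (p k : ℕ) [Fact p.Prime] :
    (∀ g : Multiplicative (ZMod (p ^ k)), ∃ k, orderOf g = p ^ k) ∧
    (∀ g h : Multiplicative (ZMod (p ^ k)), orderOf h ∣ orderOf g →
      h ∈ Subgroup.zpowers g) := by
  have hp : p.Prime := Fact.out
  have : NeZero (p ^ k) := ⟨pow_ne_zero _ hp.ne_zero⟩
  have : Fintype (Multiplicative (ZMod (p ^ k))) := Fintype.ofFinite _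
  refine ⟨fun g => ?_, fun g h hd => ?_⟩
  · have : orderOf g ∣ p ^ k := by
      have := orderOf_dvd_natCard g
      rwa [Nat.card_eq_of_bijective _ Multiplicative.toAdd.bijective, Nat.card_zmod] at this
    obtain ⟨j, -, hj⟩ := (Nat.dvd_prime_pow hp).1 this
    exact ⟨j, hj⟩
  · classical
    have h0 := orderOf_pos g
    have hle := IsCyclic.card_pow_eq_one_le (α := Multiplicative (ZMod (p ^ k))) h0
    have hsub : (Finset.univ.filter (fun x => x ∈ Subgroup.zpowers g)) ⊆
        Finset.univ.filter (fun x : Multiplicative (ZMod (p ^ k)) => x ^ orderOf g = 1) := by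
      intro x hx
      simp only [Finset.mem_filter, Finset.mem_univ, true_and] at hx ⊢
      obtain ⟨m, rfl⟩ := hx
      simp only
      rw [← zpow_natCast, ← zpow_mul, mul_comm, zpow_mul, zpow_natCast, pow_orderOf_eq_one, one_zpow]
    have hc : (Finset.univ.filter (fun x => x ∈ Subgroup.zpowers g)).card = orderOf g := by
      rw [← Fintype.card_zpowers, Fintype.card_subtype]
    have heq := Finset.eq_of_subset_of_card_le hsub (by rw [hc]; exact hle)
    have : h ∈ Finset.univ.filter (fun x => x ∈ Subgroup.zpowers g) := by
      rw [heq]; simp [orderOf_dvd_iff_pow_eq_one.1 hd]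
    simpa using this

lemma group_transfer {G H : Type*} [Group G] [Group H] (p : ℕ) (e : G ≃* H)
    (h : (∀ g : H, ∃ k, orderOf g = p ^ k) ∧
      (∀ g h : H, orderOf h ∣ orderOf g → h ∈ Subgroup.zpowers g)) :
    (∀ g : G, ∃ k, orderOf g = p ^ k) ∧
      (∀ g h : G, orderOf h ∣ orderOf g → h ∈ Subgroup.zpowers g) := by
  refine ⟨fun g => ?_, fun g k hd => ?_⟩
  · obtain ⟨k, hk⟩ := h.1 (e g)
    exact ⟨k, by rw [← hk, e.orderOf_eq]⟩
  · obtain ⟨m, hm⟩ := h.2 (e g) (e k) (by simpa [e.orderOf_eq] using hd)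
    refine ⟨m, e.injective ?_⟩
    simpa using hm

set_option linter.unusedSectionVars false
set_option linter.overlappingInstances false

variable {D : Type*} [CommRing D] [IsDomain D]

lemma hfd_assoc (h : IsHFD D) (s t : Multiset D) (hs : ∀ x ∈ s, Irreducible x)
    (ht : ∀ x ∈ t, Irreducible x) (hst : Associated s.prod t.prod) : s.card = t.card := by
  obtain ⟨u, hu⟩ := hst
  induction s using Multiset.induction_on with
  | empty =>
    by_contra hne
    obtain ⟨x, hx⟩ : ∃ x, x ∈ t := Multiset.exists_mem_of_ne_zero (by rintro rfl; simp at hne)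
    refine (ht x hx).not_isUnit (isUnit_of_dvd_unit (Multiset.dvd_prod hx) ?_)
    rw [← hu]; simp
  | cons a s _ =>
    have := h.2.2 ((a * u) ::ₘ s) t ?_ ht ?_
    · simpa using this
    · intro x hx
      rcases Multiset.mem_cons.1 hx with rfl | hx
      · exact (associated_mul_unit_right a _ u.isUnit).irreducible (hs a (by simp))
      · exact hs x (by simp [hx])
    · rw [← hu]; simp; ring

lemma ell_exists (h : IsHFD D) : ∃ l : D → ℕ,
    (∀ x y, x ≠ 0 → y ≠ 0 → l (x * y) = l x + l y) ∧
    (∀ x, Irreducible x → l x = 1) ∧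
    (∀ x, x ≠ 0 → l x = 0 → IsUnit x) ∧
    (∀ x, x ≠ 0 → l x = 1 → Irreducible x) ∧
    (∀ x y, x ≠ 0 → Associated x y → l x = l y) := by
  classical
  have hex : ∀ x : D, ∃ s : Multiset D, x ≠ 0 →
      (∀ y ∈ s, Irreducible y) ∧ Associated s.prod x := by
    intro x
    by_cases hx : x = 0
    · exact ⟨0, fun h => absurd hx h⟩
    by_cases hu : IsUnit x
    · refine ⟨0, fun _ => ⟨by simp, ?_⟩⟩
      simpa using (associated_one_iff_isUnit.2 hu).symm
    · obtain ⟨s, hs, hsx⟩ := h.2.1 x hx hu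
      exact ⟨s, fun _ => ⟨hs, by rw [hsx]⟩⟩
  choose s hs using hex
  refine ⟨fun x => (s x).card, ?_, ?_, ?_, ?_, ?_⟩
  · intro x y hx hy
    have h1 := hs x hx
    have h2 := hs y hy
    have h3 := hs (x * y) (mul_ne_zero hx hy)
    simp only
    rw [← Multiset.card_add]
    refine hfd_assoc h _ _ h3.1 ?_ ?_
    · intro z hz
      rcases Multiset.mem_add.1 hz with hz | hz
      exacts [h1.1 z hz, h2.1 z hz]
    · rw [Multiset.prod_add]
      exact h3.2.trans (h1.2.mul_mul h2.2).symm
  · intro x hx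
    have h1 := hs x hx.ne_zero
    have := hfd_assoc h (s x) {x} h1.1 (by simpa using hx) (by simpa using h1.2)
    simpa using this
  · intro x hx h0
    have h1 := (hs x hx).2
    rw [Multiset.card_eq_zero.1 h0] at h1
    simpa using associated_one_iff_isUnit.1 h1.symm
  · intro x hx h0
    have h1 := hs x hx
    obtain ⟨a, ha⟩ := Multiset.card_eq_one.1 h0
    rw [ha] at h1
    simp only [Multiset.mem_singleton, forall_eq, Multiset.prod_singleton] at h1
    exact h1.2.irreducible h1.1
  · intro x y hx hxy
    have hy : y ≠ 0 := (hxy.ne_zero_iff).1 hx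
    exact hfd_assoc h _ _ (hs x hx).1 (hs y hy).1
      ((hs x hx).2.trans (hxy.trans (hs y hy).2.symm))

variable [IsDedekindDomain D]

lemma cls_exists : ∃ c : Ideal D → ClassGroup D,
    (∀ I J, I ≠ ⊥ → J ≠ ⊥ → c (I * J) = c I * c J) ∧
    (∀ I, I ≠ ⊥ → (c I = 1 ↔ ∃ x, x ≠ 0 ∧ I = Ideal.span {x})) := by
  classical
  refine ⟨fun I => if hI : I ≠ ⊥ then
    ClassGroup.mk0 ⟨I, mem_nonZeroDivisors_iff_ne_zero.2 hI⟩ else 1, ?_, ?_⟩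
  · intro I J hI hJ
    have hIJ : I * J ≠ ⊥ := mul_ne_zero hI hJ
    simp only [dif_pos hI, dif_pos hJ, dif_pos hIJ]
    rw [← map_mul]; rfl
  · intro I hI
    simp only [dif_pos hI]
    rw [ClassGroup.mk0_eq_one_iff]
    constructor
    · rintro ⟨x, hx⟩
      refine ⟨x, ?_, hx⟩
      rintro rfl
      apply hI
      simpa using hx
    · rintro ⟨x, -, hx⟩
      exact ⟨x, hx⟩

lemma lam_exists (l : D → ℕ)
    (hmul : ∀ x y, x ≠ 0 → y ≠ 0 → l (x * y) = l x + l y)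
    (hass : ∀ x y, x ≠ 0 → Associated x y → l x = l y)
    (ht : ∀ I : Ideal D, I ≠ ⊥ → ∃ N : ℕ, 0 < N ∧ ∃ x, x ≠ 0 ∧ I ^ N = Ideal.span {x}) :
    ∃ lam : Ideal D → ℚ,
      (∀ I J, I ≠ ⊥ → J ≠ ⊥ → lam (I * J) = lam I + lam J) ∧
      (∀ x, x ≠ 0 → lam (Ideal.span {x}) = l x) := by
  classical
  have hone : l 1 = 0 := by
    have := hmul 1 1 one_ne_zero one_ne_zero
    rw [mul_one] at this; omega
  have hpow : ∀ x : D, x ≠ 0 → ∀ k : ℕ, l (x ^ k) = k * l x := by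
    intro x hx k
    induction k with
    | zero => simp [hone]
    | succ k ih => rw [pow_succ, hmul _ _ (pow_ne_zero _ hx) hx, ih]; ring
  have ht' : ∀ I : Ideal D, ∃ N : ℕ, ∃ x, I ≠ ⊥ → 0 < N ∧ x ≠ 0 ∧ I ^ N = Ideal.span {x} := by
    intro I
    by_cases hI : I = ⊥
    · exact ⟨0, 0, fun h => absurd hI h⟩
    · obtain ⟨N, hN, x, hx⟩ := ht I hI
      exact ⟨N, x, fun _ => ⟨hN, hx⟩⟩
  choose N x hNx using ht'
  have key : ∀ I : Ideal D, I ≠ ⊥ → ∀ M : ℕ, ∀ y, 0 < M → y ≠ 0 → I ^ M = Ideal.span {y} →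
      (l (x I) : ℚ) / N I = l y / M := by
    intro I hI M y hM hy hMy
    obtain ⟨hN, hx, hNI⟩ := hNx I hI
    have h1 : Ideal.span {x I ^ M} = Ideal.span {y ^ N I} := by
      rw [← Ideal.span_singleton_pow, ← Ideal.span_singleton_pow, ← hNI, ← hMy, ← pow_mul,
        ← pow_mul, mul_comm]
    have h2 := hass _ _ (pow_ne_zero _ hx) (Ideal.span_singleton_eq_span_singleton.1 h1)
    rw [hpow _ hx, hpow _ hy] at h2
    have h3 : (M : ℚ) * l (x I) = N I * l y := by exact_mod_cast h2
    have hN' : (N I : ℚ) ≠ 0 := by positivity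
    have hM' : (M : ℚ) ≠ 0 := by positivity
    field_simp
    linarith
  refine ⟨fun I => (l (x I) : ℚ) / N I, ?_, ?_⟩
  · intro I J hI hJ
    obtain ⟨hN, hx, hNI⟩ := hNx I hI
    obtain ⟨hM, hy, hMJ⟩ := hNx J hJ
    have hIJ : I * J ≠ ⊥ := mul_ne_zero hI hJ
    have := key (I * J) hIJ (N I * N J) (x I ^ N J * x J ^ N I) (Nat.mul_pos hN hM)
      (mul_ne_zero (pow_ne_zero _ hx) (pow_ne_zero _ hy)) (by
        rw [← Ideal.span_singleton_mul_span_singleton, ← Ideal.span_singleton_pow,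
          ← Ideal.span_singleton_pow, ← hNI, ← hMJ, mul_pow, ← pow_mul, ← pow_mul,
          mul_comm (N J)])
    simp only
    rw [this, hmul _ _ (pow_ne_zero _ hx) (pow_ne_zero _ hy), hpow _ hx, hpow _ hy]
    have hN' : (N I : ℚ) ≠ 0 := by positivity
    have hM' : (N J : ℚ) ≠ 0 := by positivity
    push_cast
    field_simp
    try ring
  · intro y hy
    have := key (Ideal.span {y}) (by simpa using hy) 1 y one_pos hy (pow_one _)
    simpa using this

/-- The main argument. -/
lemma main (p : ℕ) (hp : p.Prime)
    (hG : (∀ g : ClassGroup D, ∃ k, orderOf g = p ^ k) ∧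
      (∀ g h : ClassGroup D, orderOf h ∣ orderOf g → h ∈ Subgroup.zpowers g))
    (hH : IsHFD D) : IsIDPD D := by
  classical
  obtain ⟨l, lmul, lirr, lunit, lone, lass⟩ := ell_exists hH
  obtain ⟨c, cmul, cone⟩ := cls_exists (D := D)
  have c1 : c 1 = 1 := (cone 1 one_ne_zero).2 ⟨1, one_ne_zero, by simp⟩
  have cpow : ∀ I : Ideal D, I ≠ ⊥ → ∀ k : ℕ, c (I ^ k) = c I ^ k := by
    intro I hI k
    induction k with
    | zero => rw [pow_zero, pow_zero, c1]
    | succ k ih => rw [pow_succ, cmul _ _ (pow_ne_zero _ hI) hI, ih, pow_succ]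
  have opos : ∀ g : ClassGroup D, 0 < orderOf g := by
    intro g
    obtain ⟨k, hk⟩ := hG.1 g
    rw [hk]; exact pow_pos hp.pos _
  have tors : ∀ I : Ideal D, I ≠ ⊥ →
      ∃ x, x ≠ 0 ∧ I ^ orderOf (c I) = Ideal.span {x} := by
    intro I hI
    rw [← cone _ (pow_ne_zero _ hI), cpow I hI, pow_orderOf_eq_one]
  obtain ⟨lam, lammul, lamspan⟩ := lam_exists l lmul lass
    (fun I hI => ⟨_, opos _, tors I hI⟩)
  have lam1 : lam 1 = 0 := by
    have := lammul 1 1 one_ne_zero one_ne_zero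
    rw [mul_one] at this; linarith
  have lampow : ∀ I : Ideal D, I ≠ ⊥ → ∀ k : ℕ, lam (I ^ k) = k * lam I := by
    intro I hI k
    induction k with
    | zero => rw [pow_zero, lam1]; simp
    | succ k ih => rw [pow_succ, lammul _ _ (pow_ne_zero _ hI) hI, ih]; push_cast; ring
  have lamnn : ∀ I : Ideal D, I ≠ ⊥ → 0 ≤ lam I := by
    intro I hI
    obtain ⟨x, hx, hIx⟩ := tors I hI
    have h1 := lampow I hI (orderOf (c I))
    rw [hIx, lamspan x hx] at h1
    have h2 : (0 : ℚ) < orderOf (c I) := by exact_mod_cast opos _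
    by_contra hneg
    push Not at hneg
    have h3 : (0 : ℚ) ≤ l x := by positivity
    nlinarith
  have lamprime : ∀ P : Ideal D, Prime P → (orderOf (c P) : ℚ) * lam P = 1 := by
    intro P hP
    have hP0 : P ≠ ⊥ := hP.ne_zero
    obtain ⟨y, hy, hPy⟩ := tors P hP0
    rw [← lampow P hP0, hPy, lamspan y hy]
    suffices h : Irreducible y by rw [lirr y h]; norm_num
    have aux : ∀ a b : D, y = a * b → ∀ i, i ≤ orderOf (c P) → Ideal.span {a} = P ^ i →
        IsUnit a ∨ IsUnit b := by
      intro a b hab i hi hai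
      have ha : a ≠ 0 := by rintro rfl; simp at hab; exact hy hab
      have hb : b ≠ 0 := by rintro rfl; simp at hab; exact hy hab
      have h1 : c P ^ i = 1 := by
        rw [← cpow P hP0, ← hai]
        exact (cone _ (by simpa using ha)).2 ⟨a, ha, rfl⟩
      have h2 := orderOf_dvd_of_pow_eq_one h1
      rcases Nat.eq_zero_or_pos i with h0 | h0
      · left
        rw [h0, pow_zero, Ideal.one_eq_top, Ideal.span_singleton_eq_top] at hai
        exact hai
      · right
        have h3 : i = orderOf (c P) := le_antisymm hi (Nat.le_of_dvd h0 h2)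
        rw [h3, hPy, hab] at hai
        have h4 := Ideal.span_singleton_eq_span_singleton.1 hai
        have h5 : Associated (a * 1) (a * b) := by simpa using h4
        have h6 := h5.of_mul_left (Associated.refl a) ha
        exact associated_one_iff_isUnit.1 h6.symm
    refine ⟨?_, ?_⟩
    · intro hu
      rw [Ideal.span_singleton_eq_top.2 hu, ← Ideal.one_eq_top] at hPy
      exact hP.not_isUnit ((isUnit_pow_iff (opos _).ne').1 (by rw [hPy]; exact isUnit_one))
    · intro a b hab
      have hd : Ideal.span {a} ∣ P ^ orderOf (c P) := by
        rw [hPy, hab, ← Ideal.span_singleton_mul_span_singleton]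
        exact dvd_mul_right _ _
      obtain ⟨i, hi, hai⟩ := (dvd_prime_pow hP _).1 hd
      exact aux a b hab i hi (associated_iff_eq.1 hai)
  -- structure of the classes of primes
  have struct : ∀ P Q : Ideal D, Prime P → Prime Q → orderOf (c Q) ∣ orderOf (c P) →
      c Q = c P ^ (orderOf (c P) / orderOf (c Q)) := by
    intro P Q hP hQ hd
    have hP0 : P ≠ ⊥ := hP.ne_zero
    have hQ0 : Q ≠ ⊥ := hQ.ne_zero
    obtain ⟨e, he⟩ := hd
    have hQp := opos (c Q)
    have hPp := opos (c P)
    have hmem : (c Q)⁻¹ ∈ Subgroup.zpowers (c P) := inv_mem (hG.2 _ _ ⟨e, he⟩)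
    obtain ⟨m, hm⟩ := (isOfFinOrder_iff_pow_eq_one.2
      ⟨_, hPp, pow_orderOf_eq_one _⟩).mem_powers_iff_mem_zpowers.2 hmem
    simp only at hm
    have hpr : c (Q * P ^ m) = 1 := by
      rw [cmul _ _ hQ0 (pow_ne_zero _ hP0), cpow P hP0, hm, mul_inv_cancel]
    obtain ⟨x, hx, hQPx⟩ := (cone _ (mul_ne_zero hQ0 (pow_ne_zero _ hP0))).1 hpr
    have h1 : lam Q + m * lam P = l x := by
      rw [← lampow P hP0, ← lammul _ _ hQ0 (pow_ne_zero _ hP0), hQPx, lamspan x hx]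
    have h2 := lamprime P hP
    have h3 := lamprime Q hQ
    have heq : (orderOf (c P) : ℚ) = orderOf (c Q) * e := by exact_mod_cast he
    have h4 : (e : ℚ) + m = orderOf (c P) * l x := by
      rw [← h1, mul_add, heq]
      rw [heq] at h2
      linear_combination (-(e : ℚ)) * h3 - m * h2
    have h5 : e + m = orderOf (c P) * l x := by exact_mod_cast h4
    rw [he, Nat.mul_div_cancel_left _ hQp]
    have h6 : c P ^ e * c P ^ m = 1 := by
      rw [← pow_add, h5, pow_mul, pow_orderOf_eq_one, one_pow]
    rw [hm] at h6
    exact (mul_inv_eq_one.1 h6).symm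
  have induct : ∀ P : Ideal D, Prime P → ∀ I : Ideal D, I ≠ ⊥ →
      (∀ Q, Prime Q → Q ∣ I → orderOf (c Q) ∣ orderOf (c P)) →
      ∃ m : ℕ, (m : ℚ) = orderOf (c P) * lam I ∧ c I = c P ^ m := by
    intro P hP I
    induction I using UniqueFactorizationMonoid.induction_on_prime with
    | h₁ => intro h; exact absurd rfl h
    | h₂ x hx =>
      intro _ _
      have : x = 1 := by rwa [Ideal.isUnit_iff, ← Ideal.one_eq_top] at hx
      exact ⟨0, by rw [this, lam1]; simp, by rw [this, c1, pow_zero]⟩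
    | h₃ J Q hJ hQ ih =>
      intro _ hd
      obtain ⟨m, hm, hcm⟩ := ih hJ (fun Q' h1 h2 => hd Q' h1 (h2.mul_left Q))
      have hdQ := hd Q hQ (dvd_mul_right _ _)
      have hs := struct P Q hP hQ hdQ
      refine ⟨orderOf (c P) / orderOf (c Q) + m, ?_, ?_⟩
      · rw [lammul _ _ hQ.ne_zero hJ, mul_add, ← hm]
        obtain ⟨e, he⟩ := hdQ
        have h3 := lamprime Q hQ
        rw [he, Nat.mul_div_cancel_left _ (opos _)]
        push_cast
        linear_combination (-(e : ℚ)) * h3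
      · rw [cmul _ _ hQ.ne_zero hJ, pow_add, ← hs, hcm]
  have maxprime : ∀ I : Ideal D, I ≠ ⊥ → I ≠ 1 → ∃ P, Prime P ∧ P ∣ I ∧
      ∀ Q, Prime Q → Q ∣ I → orderOf (c Q) ∣ orderOf (c P) := by
    intro I hI hI1
    let F := (UniqueFactorizationMonoid.normalizedFactors I).toFinset
    have hmemF : ∀ Q, Q ∈ F ↔ Prime Q ∧ Q ∣ I := by
      intro Q
      simp only [F, Multiset.mem_toFinset]
      rw [UniqueFactorizationMonoid.mem_normalizedFactors_iff' hI, UniqueFactorizationMonoid.irreducible_iff_prime]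
      simp
    have hne : F.Nonempty := by
      obtain ⟨Q, hQ, hQI⟩ := WfDvdMonoid.exists_irreducible_factor
        (by rwa [Ideal.isUnit_iff, ← Ideal.one_eq_top]) hI
      exact ⟨Q, (hmemF Q).2 ⟨UniqueFactorizationMonoid.irreducible_iff_prime.1 hQ, hQI⟩⟩
    obtain ⟨P, hPF, hmax⟩ := F.exists_max_image (fun Q => orderOf (c Q)) hne
    obtain ⟨hP, hPI⟩ := (hmemF P).1 hPF
    refine ⟨P, hP, hPI, fun Q hQ hQI => ?_⟩
    have hle := hmax Q ((hmemF Q).2 ⟨hQ, hQI⟩)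
    obtain ⟨i, hi⟩ := hG.1 (c Q)
    obtain ⟨j, hj⟩ := hG.1 (c P)
    simp only [hi, hj] at hle ⊢
    exact pow_dvd_pow p ((Nat.pow_le_pow_iff_right hp.one_lt).1 hle)
  have princ : ∀ I : Ideal D, I ≠ ⊥ → ∀ k : ℕ, lam I = k → ∃ x, x ≠ 0 ∧ I = Ideal.span {x} := by
    intro I hI k hk
    rw [← cone I hI]
    by_cases hI1 : I = 1
    · rw [hI1, c1]
    obtain ⟨P, hP, -, hmax⟩ := maxprime I hI hI1
    obtain ⟨m, hm, hcm⟩ := induct P hP I hI hmax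
    have hm' : m = orderOf (c P) * k := by rw [hk] at hm; exact_mod_cast hm
    rw [hcm, hm', pow_mul, pow_orderOf_eq_one, one_pow]
  -- the conclusion
  refine ⟨inferInstance, hH.2.1, ?_⟩
  intro z a b hz0 hzu ha hb haz hbz hab
  have ha0 := ha.ne_zero
  have hb0 := hb.ne_zero
  have hA0 : Ideal.span {a} ≠ (⊥ : Ideal D) := by simpa using ha0
  have hB0 : Ideal.span {b} ≠ (⊥ : Ideal D) := by simpa using hb0
  have hZ0 : Ideal.span {z} ≠ (⊥ : Ideal D) := by simpa using hz0
  have hAZ : Ideal.span {a} ∣ Ideal.span {z} :=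
    Ideal.dvd_iff_le.2 (Ideal.span_singleton_le_span_singleton.2 haz)
  have hBZ : Ideal.span {b} ∣ Ideal.span {z} :=
    Ideal.dvd_iff_le.2 (Ideal.span_singleton_le_span_singleton.2 hbz)
  let S : Set (Ideal D) := {R | ∃ K, Ideal.span {a} ∣ K ∧ Ideal.span {b} ∣ K ∧
    K * R = Ideal.span {z} ∧ lam K ≤ 2}
  have hS : S.Nonempty := by
    have hL0 : Ideal.span {a} ⊓ Ideal.span {b} ≠ (⊥ : Ideal D) := by
      intro h
      apply mul_ne_zero hA0 hB0
      exact le_bot_iff.1 (h ▸ Ideal.mul_le_inf)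
    have hLZ : Ideal.span {a} ⊓ Ideal.span {b} ∣ Ideal.span {z} :=
      Ideal.dvd_iff_le.2 (le_inf (Ideal.dvd_iff_le.1 hAZ) (Ideal.dvd_iff_le.1 hBZ))
    obtain ⟨R, hR⟩ := hLZ
    refine ⟨R, _, Ideal.dvd_iff_le.2 inf_le_left, Ideal.dvd_iff_le.2 inf_le_right, hR.symm, ?_⟩
    obtain ⟨T, hT⟩ : Ideal.span {a} ⊓ Ideal.span {b} ∣ Ideal.span {a} * Ideal.span {b} :=
      Ideal.dvd_iff_le.2 Ideal.mul_le_inf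
    have hT0 : T ≠ ⊥ := by
      rintro rfl
      rw [Ideal.mul_bot] at hT
      exact mul_ne_zero hA0 hB0 hT
    have h1 := lammul _ _ hA0 hB0
    rw [hT, lammul _ _ hL0 hT0, lamspan a ha0, lamspan b hb0, lirr a ha, lirr b hb] at h1
    have h2 := lamnn T hT0
    push_cast at h1
    linarith
  obtain ⟨R, ⟨K, hAK, hBK, hKR, hK2⟩, hRmax⟩ := set_has_maximal_iff_noetherian.2
    (inferInstance : IsNoetherian D D) S hS
  have hK0 : K ≠ ⊥ := by rintro rfl; rw [Ideal.bot_mul] at hKR; exact hZ0 hKR.symm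
  have hR0 : R ≠ ⊥ := by rintro rfl; rw [Ideal.mul_bot] at hKR; exact hZ0 hKR.symm
  have hlz : lam K + lam R = l z := by rw [← lammul _ _ hK0 hR0, hKR, lamspan z hz0]
  have hK : lam K = 2 := by
    by_contra hne
    have hlt : lam K < 2 := lt_of_le_of_ne hK2 hne
    by_cases hR1 : R = 1
    · rw [hR1, lam1, add_zero] at hlz
      rw [hlz] at hlt
      have h1 : l z < 2 := by exact_mod_cast hlt
      have h2 : l z ≠ 0 := fun h => hzu (lunit z hz0 h)
      have h3 : Irreducible z := lone z hz0 (by omega)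
      exact hab ((ha.associated_of_dvd h3 haz).trans (hb.associated_of_dvd h3 hbz).symm)
    · obtain ⟨P, hP, ⟨R', hR'⟩, hmax⟩ := maxprime R hR0 hR1
      obtain ⟨m, hm, -⟩ := induct P hP R hR0 hmax
      have hP0 : P ≠ ⊥ := hP.ne_zero
      have hR'0 : R' ≠ ⊥ := by rintro rfl; rw [Ideal.mul_bot] at hR'; exact hR0 hR'
      have hlt' : R < R' := by
        refine lt_of_le_of_ne (by rw [hR']; exact Ideal.mul_le_right) ?_
        intro h
        rw [← h] at hR'
        have : 1 * R = P * R := by rw [one_mul]; exact hR'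
        exact hP.ne_one (mul_right_cancel₀ hR0 this).symm
      have hover : 2 < lam (K * P) := by
        by_contra hle
        push Not at hle
        exact hRmax R' ⟨K * P, hAK.mul_right P, hBK.mul_right P,
          by rw [mul_assoc, ← hR', hKR], hle⟩ hlt'
      rw [lammul _ _ hK0 hP0] at hover
      have hlp := lamprime P hP
      have hnp : (0 : ℚ) < orderOf (c P) := by exact_mod_cast opos _
      set n := orderOf (c P) with hn
      have e1 : (n : ℚ) * (2 - lam K) = ((2 * n - n * l z + m : ℤ) : ℚ) := by
        push_cast
        rw [hm, ← hlz]; ring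
      have e2 : (0 : ℚ) < ((2 * n - n * l z + m : ℤ) : ℚ) := by
        rw [← e1]; exact mul_pos hnp (by linarith)
      have e3 : ((2 * n - n * l z + m : ℤ) : ℚ) < 1 := by
        rw [← e1, ← hlp]; exact mul_lt_mul_of_pos_left (by linarith) hnp
      have e2' : (0 : ℤ) < (2 * n - n * l z + m : ℤ) := by exact_mod_cast e2
      have e3' : (2 * n - n * l z + m : ℤ) < 1 := by exact_mod_cast e3
      omega
  obtain ⟨w, hw0, hKw⟩ := princ K hK0 2 (by rw [hK]; norm_num)
  rw [hKw, lamspan w hw0] at hK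
  have hlw : l w = 2 := by exact_mod_cast hK
  have hdvd : ∀ x y : D, Ideal.span {x} ∣ Ideal.span {y} → x ∣ y := fun x y h =>
    Ideal.span_singleton_le_span_singleton.1 (Ideal.dvd_iff_le.1 h)
  obtain ⟨a', ha'⟩ := hdvd a w (hKw ▸ hAK)
  obtain ⟨b', hb'⟩ := hdvd b w (hKw ▸ hBK)
  have ha'0 : a' ≠ 0 := by rintro rfl; rw [mul_zero] at ha'; exact hw0 ha'
  have hb'0 : b' ≠ 0 := by rintro rfl; rw [mul_zero] at hb'; exact hw0 hb'
  refine ⟨a', b', lone a' ha'0 ?_, lone b' hb'0 ?_, ?_, ?_⟩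
  · rw [ha', lmul _ _ ha0 ha'0, lirr a ha] at hlw; omega
  · rw [hb', lmul _ _ hb0 hb'0, lirr b hb] at hlw; omega
  · rw [← ha', ← hb']
  · rw [← hb']
    exact hdvd w z (by rw [← hKw, ← hKR]; exact dvd_mul_right _ _)

end IDPDProof

/-- A Dedekind domain HFD whose class group is `ℤ/p^kℤ` (some `k ≥ 1`) or the Prüfer
`p`-group is an IDPD (Theorem 3.14). -/
theorem isIDPD_of_classGroup_p_primary (p : ℕ) [Fact p.Prime]
    (D : Type*) [CommRing D] [IsDomain D] [IsDedekindDomain D]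
    (h : (∃ k : ℕ, 1 ≤ k ∧ Nonempty (ClassGroup D ≃* Multiplicative (ZMod (p ^ k)))) ∨
      Nonempty (ClassGroup D ≃* Multiplicative (PruferGroup p)))
    (hHFD : IsHFD D) :
    IsIDPD D := by

  refine IDPDProof.main p Fact.out ?_ hHFD
  rcases h with ⟨k, -, ⟨e⟩⟩ | ⟨⟨e⟩⟩
  · exact IDPDProof.group_transfer p e (IDPDProof.group_zmod p k)
  · exact IDPDProof.group_transfer p e (IDPDProof.group_prufer p)
end

section
/- Let D be a Dedekind domain whose ideal class group ClassGroup D is a finite cyclic group of order n, and assume D is an HFD. Then for each divisor r of n there is at most one element of ClassGroup D of order r that is the class of a nonzero prime ideal; equivalently, if 𝔭 and 𝔮 are nonzero prime ideals of D whose classes [𝔭] and [𝔮] have the same order in ClassGroup D, then [𝔭] = [𝔮]. -/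
open scoped nonZeroDivisors

theorem aux_irred {D : Type*} [CommRing D] [IsDomain D] [IsDedekindDomain D]
    (P Q : (Ideal D)⁰) (hP : (P : Ideal D).IsPrime) (hQ : (Q : Ideal D).IsPrime)
    (m : ℕ) (hm : m < orderOf (ClassGroup.mk0 P)) (x : D)
    (hx : Ideal.span {x} = (P : Ideal D) ^ m * Q) : Irreducible x := by
  have hP0 : (P : Ideal D) ≠ 0 := nonZeroDivisors.coe_ne_zero P
  have hQ0 : (Q : Ideal D) ≠ 0 := nonZeroDivisors.coe_ne_zero Q
  have hPp : Prime (P : Ideal D) := Ideal.prime_of_isPrime hP0 hP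
  have hQp : Prime (Q : Ideal D) := Ideal.prime_of_isPrime hQ0 hQ
  have key : ∀ y z : D, x = y * z → (Q : Ideal D) ∣ Ideal.span {y} → IsUnit z := by
    rintro y z rfl ⟨I, hI⟩
    rw [← Ideal.span_singleton_mul_span_singleton, hI, mul_comm ((P : Ideal D) ^ m),
      mul_assoc] at hx
    have h2 := mul_left_cancel₀ hQ0 hx
    have h3 : Ideal.span {z} ∣ (P : Ideal D) ^ m := ⟨I, by rw [← h2, mul_comm]⟩
    obtain ⟨j, hj, hj2⟩ := (dvd_prime_pow hPp m).1 h3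
    rw [associated_iff_eq] at hj2
    have h4 : (ClassGroup.mk0 P) ^ j = 1 := by
      rw [← map_pow, ClassGroup.mk0_eq_one_iff]
      rw [SubmonoidClass.coe_pow, ← hj2]
      exact ⟨⟨z, rfl⟩⟩
    have h5 : j = 0 := by
      by_contra hne
      have := orderOf_le_of_pow_eq_one (Nat.pos_of_ne_zero hne) h4
      omega
    rw [h5, pow_zero, Ideal.one_eq_top, Ideal.span_singleton_eq_top] at hj2
    exact hj2
  constructor
  · intro hu
    rw [Ideal.span_singleton_eq_top.2 hu] at hx
    apply hQp.not_isUnit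
    rw [← Ideal.one_eq_top] at hx
    exact IsUnit.of_mul_eq_one_right _ hx.symm
  · intro y z hyz
    have : (Q : Ideal D) ∣ Ideal.span {y} * Ideal.span {z} := by
      rw [Ideal.span_singleton_mul_span_singleton, ← hyz, hx]
      exact dvd_mul_left _ _
    rcases hQp.dvd_or_dvd this with h | h
    · exact Or.inr (key y z hyz h)
    · exact Or.inl (key z y (by rw [hyz, mul_comm]) h)

theorem aux_gen {D : Type*} [CommRing D] [IsDomain D] [IsDedekindDomain D]
    (P Q : (Ideal D)⁰) (m : ℕ) (h : ClassGroup.mk0 P ^ m * ClassGroup.mk0 Q = 1) :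
    ∃ x : D, Ideal.span {x} = (P : Ideal D) ^ m * Q := by
  rw [← map_pow, ← map_mul, ClassGroup.mk0_eq_one_iff] at h
  obtain ⟨⟨x, hx⟩⟩ := h
  exact ⟨x, by rw [← SubmonoidClass.coe_pow]; exact hx.symm⟩

/-- In a Dedekind domain HFD with finite cyclic class group, two classes of nonzero
prime ideals with the same order in the class group coincide (Lemma 3.16). -/
theorem classes_of_primes_eq_of_orderOf_eq (D : Type*) [CommRing D] [IsDomain D]
    [IsDedekindDomain D] (n : ℕ) (hn : 0 < n)
    (hcyc : IsCyclic (ClassGroup D)) (hcard : Nat.card (ClassGroup D) = n)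
    (hHFD : IsHFD D) :
    ∀ P Q : (Ideal D)⁰, (P : Ideal D).IsPrime → (Q : Ideal D).IsPrime →
      orderOf (ClassGroup.mk0 P) = orderOf (ClassGroup.mk0 Q) →
      ClassGroup.mk0 P = ClassGroup.mk0 Q := by
  intro P Q hP hQ hord
  have hfin : Finite (ClassGroup D) := Nat.finite_of_card_ne_zero (by omega)
  have hr : 0 < orderOf (ClassGroup.mk0 P) := orderOf_pos _
  have hmem : ClassGroup.mk0 Q ∈ Subgroup.zpowers (ClassGroup.mk0 P) := by
    classical
    have := Fintype.ofFinite (ClassGroup D)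
    have h1 := IsCyclic.card_pow_eq_one_le (α := ClassGroup D) hr
    have hsub : (Subgroup.zpowers (ClassGroup.mk0 P) : Set (ClassGroup D)).toFinset ⊆
        Finset.univ.filter (fun a => a ^ orderOf (ClassGroup.mk0 P) = 1) := by
      intro a ha
      simp only [Set.mem_toFinset, SetLike.mem_coe] at ha
      obtain ⟨k, rfl⟩ := Subgroup.mem_zpowers_iff.1 ha
      simp only [Finset.mem_filter, Finset.mem_univ, true_and]
      rw [← zpow_natCast, zpow_comm, zpow_natCast, pow_orderOf_eq_one, one_zpow]
    have heq := Finset.eq_of_subset_of_card_le hsub (by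
      refine h1.trans (le_of_eq ?_)
      rw [Set.toFinset_card, ← Nat.card_eq_fintype_card]
      exact (Nat.card_zpowers _).symm)
    have : ClassGroup.mk0 Q ∈
        Finset.univ.filter (fun a => a ^ orderOf (ClassGroup.mk0 P) = 1) := by
      simp [hord, pow_orderOf_eq_one]
    rw [← heq] at this
    simpa using this
  obtain ⟨k, hk, hkQ⟩ : ∃ k < orderOf (ClassGroup.mk0 P),
      ClassGroup.mk0 P ^ k = ClassGroup.mk0 Q := by
    classical
    rw [mem_zpowers_iff_mem_range_orderOf] at hmem
    simpa using hmem
  rcases Nat.eq_zero_or_pos k with rfl | hk0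
  · rw [pow_zero] at hkQ
    rw [← hkQ, orderOf_one, orderOf_eq_one_iff] at hord
    rw [hord, hkQ]
  generalize hrr : orderOf (ClassGroup.mk0 P) = r at *
  have hP0 := pow_orderOf_eq_one (ClassGroup.mk0 P)
  have hQ0 := pow_orderOf_eq_one (ClassGroup.mk0 Q)
  rw [hrr] at hP0
  rw [← hord] at hQ0
  obtain ⟨p, hp⟩ := aux_gen P P (r - 1) (by rw [← pow_succ, Nat.sub_add_cancel hr, hP0])
  obtain ⟨q, hq⟩ := aux_gen Q Q (r - 1) (by rw [← pow_succ, Nat.sub_add_cancel hr, hQ0])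
  obtain ⟨x, hx⟩ := aux_gen P Q (r - k) (by
    rw [← hkQ, ← pow_add, Nat.sub_add_cancel hk.le, hP0])
  have ip := aux_irred P P hP hP _ (by omega) p hp
  have iq := aux_irred Q Q hQ hQ _ (by omega) q hq
  have ix := aux_irred P Q hP hQ _ (by omega) x hx
  rw [← pow_succ, Nat.sub_add_cancel hr] at hp hq
  have has : Associated (p ^ (r - k) * q) (x ^ r) := by
    rw [← Ideal.span_singleton_eq_span_singleton, ← Ideal.span_singleton_mul_span_singleton,
      ← Ideal.span_singleton_pow, ← Ideal.span_singleton_pow, hp, hq, hx, mul_pow, ← pow_mul,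
      ← pow_mul, mul_comm r]
  obtain ⟨u, hu⟩ := has
  have iq' : Irreducible (q * u) := (irreducible_mul_units u).2 iq
  have hlen := hHFD.2.2 (Multiset.replicate r x) ((q * u) ::ₘ Multiset.replicate (r - k) p)
    (fun a ha => by rw [Multiset.eq_of_mem_replicate ha]; exact ix)
    (fun a ha => by
      rcases Multiset.mem_cons.1 ha with rfl | ha
      · exact iq'
      · rw [Multiset.eq_of_mem_replicate ha]; exact ip)
    (by rw [Multiset.prod_cons, Multiset.prod_replicate, Multiset.prod_replicate, ← hu]; ring)
  simp only [Multiset.card_replicate, Multiset.card_cons] at hlen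
  have : k = 1 := by omega
  rw [← hkQ, this, pow_one]
end

section
/- Let D be a Dedekind domain that is an HFD, whose ideal class group ClassGroup D is a finite cyclic group of order n, and suppose there is a nonzero prime ideal 𝔭 of D whose class [𝔭] generates ClassGroup D. If 𝔮 is a nonzero prime ideal of D and s is an integer with 1 ≤ s ≤ n and [𝔮] = [𝔭]^s, then s divides n. -/
open scoped nonZeroDivisors

theorem irred_of_span_eq {D : Type*} [CommRing D] [IsDomain D] [IsDedekindDomain D]
    (I : (Ideal D)⁰) (h1 : (I : Ideal D) ≠ 1)
    (h : ∀ J : (Ideal D)⁰, (J : Ideal D) ∣ I → ClassGroup.mk0 J = 1 → J = 1 ∨ J = I)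
    (c : D) (hc : (I : Ideal D) = Ideal.span {c}) : Irreducible c := by
  have hI0 : (I : Ideal D) ≠ 0 := nonZeroDivisors.ne_zero I.2
  have hc0 : c ≠ 0 := by
    rintro rfl
    apply hI0
    rw [hc]; simp
  refine ⟨fun hu => h1 ?_, ?_⟩
  · rw [hc, Ideal.span_singleton_eq_top.mpr hu, Ideal.one_eq_top]
  · intro x y hxy
    have hx0 : x ≠ 0 := by rintro rfl; simp_all
    have hm : Ideal.span {x} ∈ (Ideal D)⁰ := by
      rw [mem_nonZeroDivisors_iff_ne_zero]
      simpa using hx0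
    have hd : Ideal.span {x} ∣ (I : Ideal D) :=
      ⟨Ideal.span {y}, by rw [hc, Ideal.span_singleton_mul_span_singleton, hxy]⟩
    rcases h ⟨_, hm⟩ hd ((ClassGroup.mk0_eq_one_iff hm).mpr ⟨x, rfl⟩) with h' | h'
    · left
      have := congrArg Subtype.val h'
      rw [Submonoid.coe_one, Ideal.one_eq_top] at this
      exact Ideal.span_singleton_eq_top.mp this
    · right
      have := congrArg Subtype.val h'
      simp only at this
      rw [hc, Ideal.span_singleton_eq_span_singleton, hxy] at this
      obtain ⟨u, hu⟩ := this
      have : (u : D) = y := mul_left_cancel₀ hx0 hu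
      exact this ▸ u.isUnit

theorem exists_gen {D : Type*} [CommRing D] [IsDomain D] [IsDedekindDomain D]
    (I : (Ideal D)⁰) (h : ClassGroup.mk0 I = 1) : ∃ c : D, (I : Ideal D) = Ideal.span {c} := by
  obtain ⟨c, hc⟩ := (ClassGroup.mk0_eq_one_iff I.2).mp h
  exact ⟨c, hc⟩

theorem irred_pow_order {D : Type*} [CommRing D] [IsDomain D] [IsDedekindDomain D]
    (P : (Ideal D)⁰) (hP : (P : Ideal D).IsPrime) (h0 : 0 < orderOf (ClassGroup.mk0 P)) :
    ∃ a : D, Irreducible a ∧ (P : Ideal D) ^ orderOf (ClassGroup.mk0 P) = Ideal.span {a} := by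
  have hpr : Prime (P : Ideal D) := Ideal.prime_of_isPrime (nonZeroDivisors.ne_zero P.2) hP
  obtain ⟨a, ha⟩ := exists_gen (P ^ orderOf (ClassGroup.mk0 P)) (by rw [map_pow, pow_orderOf_eq_one])
  refine ⟨a, irred_of_span_eq _ ?_ ?_ a ha, by simpa using ha⟩
  · intro h
    have h2 : IsUnit ((P : Ideal D) ^ orderOf (ClassGroup.mk0 P)) := by
      rw [SubmonoidClass.coe_pow] at h; rw [h]; exact isUnit_one
    exact hpr.not_isUnit ((isUnit_pow_iff h0.ne').mp h2)
  · intro J hJ hJ1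
    rw [SubmonoidClass.coe_pow, dvd_prime_pow hpr] at hJ
    obtain ⟨i, hi, hJ⟩ := hJ
    have hJ : J = P ^ i := Subtype.ext (by simpa using associated_iff_eq.mp hJ)
    subst hJ
    rw [map_pow] at hJ1
    have hd := orderOf_dvd_of_pow_eq_one hJ1
    rcases Nat.eq_zero_or_pos i with rfl | hpos
    · left; simp
    · right; rw [le_antisymm hi (Nat.le_of_dvd hpos hd)]

/-- Lemma 3.17: in a Dedekind domain HFD with cyclic class group of order `n`
generated by the class of a nonzero prime ideal `P`, if the class of a nonzero prime
ideal `Q` equals `[P]^s` with `1 ≤ s ≤ n`, then `s ∣ n`. -/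
theorem dvd_of_prime_class_eq_pow (D : Type*) [CommRing D] [IsDomain D]
    [IsDedekindDomain D] (n : ℕ) (hn : 0 < n)
    (hcard : Nat.card (ClassGroup D) = n)
    (hHFD : IsHFD D)
    (P : (Ideal D)⁰) (hP : (P : Ideal D).IsPrime)
    (hgen : ∀ g : ClassGroup D, g ∈ Subgroup.zpowers (ClassGroup.mk0 P))
    (Q : (Ideal D)⁰) (hQ : (Q : Ideal D).IsPrime)
    (s : ℕ) (hs1 : 1 ≤ s) (hsn : s ≤ n)
    (hQP : ClassGroup.mk0 Q = (ClassGroup.mk0 P) ^ s) :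
    s ∣ n := by
  have : Finite (ClassGroup D) := Nat.finite_of_card_ne_zero (by omega)
  have hord : orderOf (ClassGroup.mk0 P) = n := by
    rw [orderOf_eq_card_of_forall_mem_zpowers hgen, hcard]
  obtain ⟨a, ha, haP⟩ := irred_pow_order P hP (orderOf_pos _)
  obtain ⟨b, hb, hbQ⟩ := irred_pow_order Q hQ (orderOf_pos _)
  rw [hord] at haP
  set m := orderOf (ClassGroup.mk0 Q) with hm
  have hprP : Prime (P : Ideal D) := Ideal.prime_of_isPrime (nonZeroDivisors.ne_zero P.2) hP
  have hprQ : Prime (Q : Ideal D) := Ideal.prime_of_isPrime (nonZeroDivisors.ne_zero Q.2) hQ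
  have hcl : ∀ i, ClassGroup.mk0 P ^ i = 1 ↔ n ∣ i := fun i => by
    rw [← orderOf_dvd_iff_pow_eq_one, hord]
  obtain ⟨c, hc⟩ := exists_gen (P ^ (n - s) * Q) (by
    rw [map_mul, map_pow, hQP, ← pow_add, hcl, Nat.sub_add_cancel hsn])
  have hcirr : Irreducible c := by
    refine irred_of_span_eq _ ?_ ?_ c hc
    · intro h
      rw [Submonoid.coe_mul] at h
      exact hprQ.not_isUnit (isUnit_of_dvd_one (h ▸ dvd_mul_left _ _))
    · intro J hJ hJ1
      rw [Submonoid.coe_mul, SubmonoidClass.coe_pow] at hJ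
      obtain ⟨A, B, hA, hB, hAB⟩ := exists_dvd_and_dvd_of_dvd_mul hJ
      rw [dvd_prime_pow hprP] at hA
      obtain ⟨i, hi, hA⟩ := hA
      have hA := associated_iff_eq.mp hA
      rcases hprQ.irreducible.dvd_iff.mp hB with hB | hB
      · have hB : B = 1 := by simpa using hB
        have hJ : J = P ^ i := Subtype.ext (by simp [hAB, hA, hB])
        subst hJ
        rw [map_pow, hcl] at hJ1
        left
        rw [Nat.eq_zero_of_dvd_of_lt hJ1 (by omega), pow_zero]
      · have hB := (associated_iff_eq.mp hB).symm
        have hJ : J = P ^ i * Q := Subtype.ext (by simp [hAB, hA, hB])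
        subst hJ
        rw [map_mul, map_pow, hQP, ← pow_add, hcl] at hJ1
        have := Nat.le_of_dvd (by omega) hJ1
        right
        rw [show i = n - s by omega]
  have hsm : n ∣ s * m := by
    rw [← hcl, pow_mul, ← hQP, pow_orderOf_eq_one]
  have hk : n ∣ (n - s) * m := by
    rw [Nat.sub_mul]
    exact Nat.dvd_sub (dvd_mul_right _ _) hsm
  obtain ⟨k, hk⟩ := hk
  have hass : Associated (a ^ k * b) (c ^ m) := by
    rw [← Ideal.span_singleton_eq_span_singleton, ← Ideal.span_singleton_mul_span_singleton,
      ← Ideal.span_singleton_pow, ← Ideal.span_singleton_pow, ← haP, ← hbQ, ← hc,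
      Submonoid.coe_mul, SubmonoidClass.coe_pow, mul_pow, ← pow_mul, ← pow_mul, hk]
  obtain ⟨u, hu⟩ := hass
  have hlen := hHFD.2.2 ((b * u) ::ₘ Multiset.replicate k a) (Multiset.replicate m c)
    (by
      intro p hp
      rcases Multiset.mem_cons.mp hp with rfl | hp
      · exact (irreducible_mul_units u).mpr hb
      · rw [Multiset.eq_of_mem_replicate hp]; exact ha)
    (by
      intro q hq
      rw [Multiset.eq_of_mem_replicate hq]; exact hcirr)
    (by
      rw [Multiset.prod_cons, Multiset.prod_replicate, Multiset.prod_replicate, ← hu]; ring)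
  simp only [Multiset.card_cons, Multiset.card_replicate] at hlen
  refine ⟨m, ?_⟩
  obtain ⟨t, rfl⟩ := Nat.exists_eq_add_of_le hsn
  rw [← hlen] at hk ⊢
  rw [Nat.add_sub_cancel_left] at hk
  nlinarith
end

section
/- Let D be a Dedekind domain whose ideal class group ClassGroup D is a finite cyclic group of order n, and suppose there is a nonzero prime ideal 𝔭 of D whose class [𝔭] generates ClassGroup D. Let S = { s : 1 ≤ s ≤ n and there exists a nonzero prime ideal 𝔮 of D with [𝔮] = [𝔭]^s }. Assume S is totally ordered by divisibility (for all s, t ∈ S, s divides t or t divides s). If D is an HFD, then D is an IDPD. -/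
open scoped nonZeroDivisors

set_option linter.overlappingInstances false

open UniqueFactorizationMonoid in
/-- additive weight of an ideal -/
noncomputable def idealWt {D : Type*} [CommRing D] [IsDomain D] [IsDedekindDomain D]
    (w : Ideal D → ℕ) (I : Ideal D) : ℕ := ((normalizedFactors I).map w).sum

section helpers
open UniqueFactorizationMonoid
variable {D : Type*} [CommRing D] [IsDomain D] [IsDedekindDomain D]

theorem idealWt_mul (w : Ideal D → ℕ) {I J : Ideal D} (hI : I ≠ 0) (hJ : J ≠ 0) :
    idealWt w (I * J) = idealWt w I + idealWt w J := by
  simp [idealWt, normalizedFactors_mul hI hJ]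

theorem idealWt_one (w : Ideal D → ℕ) : idealWt w (1 : Ideal D) = 0 := by
  rw [idealWt, normalizedFactors_one]; simp

theorem idealWt_pow (w : Ideal D → ℕ) (I : Ideal D) (k : ℕ) :
    idealWt w (I ^ k) = k * idealWt w I := by
  rw [idealWt, normalizedFactors_pow, Multiset.map_nsmul, Multiset.sum_nsmul]; rfl

theorem idealWt_prime (w : Ideal D → ℕ) {Q : Ideal D} (hQ : Prime Q) :
    idealWt w Q = w Q := by
  simp [idealWt, normalizedFactors_irreducible hQ.irreducible]

theorem idealWt_prod (w : Ideal D → ℕ) (M : Multiset (Ideal D)) (hM : ∀ Q ∈ M, Prime Q) :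
    idealWt w M.prod = (M.map w).sum := by
  rw [idealWt, normalizedFactors_prod_of_prime hM]

theorem idealWt_eq_zero (w : Ideal D → ℕ) (hw : ∀ I, 1 ≤ w I) {I : Ideal D} (hI : I ≠ 0)
    (h : idealWt w I = 0) : I = 1 := by
  have : normalizedFactors I = 0 := by
    by_contra hne
    obtain ⟨Q, hQ⟩ := Multiset.exists_mem_of_ne_zero hne
    have h1 : w Q ≤ idealWt w I :=
      Multiset.single_le_sum (by simp) _ (Multiset.mem_map_of_mem w hQ)
    have := hw Q
    omega
  have h2 := Ideal.prod_normalizedFactors_eq_self hI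
  rw [this] at h2
  simpa using h2.symm

theorem idealWt_class (w : Ideal D → ℕ) (g : ClassGroup D)
    (hw : ∀ (I : Ideal D) (h : I ∈ nonZeroDivisors (Ideal D)), ClassGroup.mk0 ⟨I, h⟩ = g ^ w I)
    (I : Ideal D) (h : I ∈ nonZeroDivisors (Ideal D)) :
    ClassGroup.mk0 ⟨I, h⟩ = g ^ idealWt w I := by
  induction I using induction_on_prime with
  | h₁ => simp at h
  | h₂ x hx =>
    obtain rfl : x = 1 := by simpa using hx
    rw [idealWt_one, pow_zero]
    exact map_one ClassGroup.mk0
  | h₃ a p ha hp ih =>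
    have ha' := mem_nonZeroDivisors_of_ne_zero ha
    have hp' := mem_nonZeroDivisors_of_ne_zero hp.ne_zero
    rw [idealWt_mul w hp.ne_zero ha, pow_add, ← ih ha', idealWt_prime w hp, ← hw p hp', ← map_mul]
    rfl

/-- greedy sub-multiset of sum n -/
theorem exists_sub_sum {α : Type*} (f : α → ℕ) (n : ℕ) (M : Multiset α) (hn : 0 < n)
    (hdvd : ∀ a ∈ M, f a ∣ n) (hchain : ∀ a ∈ M, ∀ b ∈ M, f a ∣ f b ∨ f b ∣ f a)
    (hsum : n ≤ (M.map f).sum) : ∃ N ≤ M, (N.map f).sum = n := by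
  classical
  induction hk : M.card generalizing M with
  | zero =>
    obtain rfl := Multiset.card_eq_zero.mp hk
    exact ⟨0, le_rfl, by simp at hsum ⊢; omega⟩
  | succ k ih =>
    rcases hsum.eq_or_lt with h | h
    · exact ⟨M, le_rfl, h.symm⟩
    have hpos : ∀ b ∈ M, 0 < f b := by
      intro b hb
      exact Nat.pos_of_dvd_of_pos (hdvd b hb) hn
    have hne : M.toFinset.Nonempty := by
      obtain ⟨a, ha⟩ := Multiset.card_pos_iff_exists_mem.mp (by omega : 0 < M.card)
      exact ⟨a, by simpa using ha⟩
    obtain ⟨a, ha, hmin⟩ := M.toFinset.exists_min_image f hne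
    simp only [Multiset.mem_toFinset] at ha hmin
    have hall : ∀ b ∈ M, f a ∣ f b := by
      intro b hb
      rcases hchain a ha b hb with h1 | h1
      · exact h1
      · rw [(Nat.le_of_dvd (hpos a ha) h1).antisymm (hmin b hb)]
    have hs : f a ∣ (M.map f).sum := by
      apply Multiset.dvd_sum
      intro x hx
      obtain ⟨c, hc', rfl⟩ := Multiset.mem_map.mp hx
      exact hall c hc'
    have hd := Nat.le_of_dvd (by omega) (Nat.dvd_sub hs (hdvd a ha))
    have he : (M.map f).sum = f a + ((M.erase a).map f).sum := by
      conv_lhs => rw [← Multiset.cons_erase ha]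
      simp
    obtain ⟨N, hN, hN'⟩ := ih (M.erase a) (fun a ha => hdvd a (Multiset.mem_of_mem_erase ha))
          (fun a ha c hc => hchain a (Multiset.mem_of_mem_erase ha) c (Multiset.mem_of_mem_erase hc))
          (by omega) (by rw [Multiset.card_erase_of_mem ha, hk]; rfl)
    exact ⟨N, hN.trans (Multiset.erase_le _ _), hN'⟩

theorem hfd_assoc (hHFD : IsHFD D) (s t : Multiset D) (hs : ∀ p ∈ s, Irreducible p)
    (ht : ∀ q ∈ t, Irreducible q) (ht0 : t ≠ 0) (h : Associated t.prod s.prod) :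
    Multiset.card s = Multiset.card t := by
  obtain ⟨c, hc⟩ := h
  obtain ⟨a, ha⟩ := Multiset.exists_mem_of_ne_zero ht0
  obtain ⟨t', rfl⟩ := Multiset.exists_cons_of_mem ha
  have := hHFD.2.2 s ((a * c) ::ₘ t') hs ?_ ?_
  · simpa using this
  · intro q hq
    rcases Multiset.mem_cons.mp hq with rfl | hq
    · exact (irreducible_mul_units c).mpr (ht a (by simp))
    · exact ht q (by simp [hq])
  · rw [← hc]; simp; ring

end helpers

/-- Theorem 3.19: let `D` be a Dedekind domain with cyclic class group of order `n`
generated by the class of a nonzero prime ideal `P`, and suppose the set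
`S = {s | 1 ≤ s ≤ n and [P]^s is the class of a nonzero prime ideal}` is totally
ordered by divisibility. If `D` is an HFD, then `D` is an IDPD. -/
theorem isIDPD_of_totally_ordered_prime_classes (D : Type*) [CommRing D] [IsDomain D]
    [IsDedekindDomain D] (n : ℕ) (hn : 0 < n)
    (hcard : Nat.card (ClassGroup D) = n)
    (P : (Ideal D)⁰) (hP : (P : Ideal D).IsPrime)
    (hgen : ∀ g : ClassGroup D, g ∈ Subgroup.zpowers (ClassGroup.mk0 P))
    (hchain : ∀ s t : ℕ,
      (1 ≤ s ∧ s ≤ n ∧ ∃ Q : (Ideal D)⁰, (Q : Ideal D).IsPrime ∧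
        ClassGroup.mk0 Q = (ClassGroup.mk0 P) ^ s) →
      (1 ≤ t ∧ t ≤ n ∧ ∃ Q : (Ideal D)⁰, (Q : Ideal D).IsPrime ∧
        ClassGroup.mk0 Q = (ClassGroup.mk0 P) ^ t) →
      s ∣ t ∨ t ∣ s)
    (hHFD : IsHFD D) :
    IsIDPD D := by
  classical
  set g := ClassGroup.mk0 P with hg
  have hord : orderOf g = n := by
    rw [← hcard, orderOf_eq_card_of_forall_mem_zpowers hgen]
  have hfin : Finite (ClassGroup D) := Nat.finite_of_card_ne_zero (by omega)
  have hex : ∀ I : Ideal D, ∃ s : ℕ, 1 ≤ s ∧ s ≤ n ∧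
      ∀ h : I ∈ nonZeroDivisors (Ideal D), ClassGroup.mk0 ⟨I, h⟩ = g ^ s := by
    intro I
    by_cases h : I ∈ nonZeroDivisors (Ideal D)
    · obtain ⟨k, hk⟩ := (mem_zpowers_iff_mem_range_orderOf.mp (hgen (ClassGroup.mk0 ⟨I, h⟩)) :
        _ ∈ Finset.image _ _) |> Finset.mem_image.mp
      rw [hord, Finset.mem_range] at hk
      rcases Nat.eq_zero_or_pos k with rfl | hk0
      · refine ⟨n, hn, le_rfl, fun _ => ?_⟩
        rw [← hk.2, ← hord, pow_orderOf_eq_one, pow_zero]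
      · exact ⟨k, hk0, hk.1.le, fun _ => hk.2.symm⟩
    · exact ⟨1, le_rfl, hn, fun h' => absurd h' h⟩
  choose w hw1 hwn hwc using hex
  have hcls := idealWt_class w g hwc
  have hmul : ∀ {I J : Ideal D}, I ≠ 0 → J ≠ 0 →
    idealWt w (I * J) = idealWt w I + idealWt w J := fun hI hJ => idealWt_mul w hI hJ
  -- principal iff weight divisible by n
  have hprin : ∀ I : Ideal D, I ≠ 0 → n ∣ idealWt w I → ∃ x : D, x ≠ 0 ∧ I = Ideal.span {x} := by
    intro I hI hd
    have h := mem_nonZeroDivisors_of_ne_zero hI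
    have h1 := hcls I h
    rw [orderOf_dvd_iff_pow_eq_one.mp (hord ▸ hd), ClassGroup.mk0_eq_one_iff] at h1
    obtain ⟨x, hx⟩ := h1.principal
    refine ⟨x, ?_, hx⟩
    rintro rfl
    apply hI
    simpa using hx
  have hsp0 : ∀ {x : D}, x ≠ 0 → Ideal.span {x} ≠ (0 : Ideal D) := by
    intro x hx; simpa using hx
  have hprin' : ∀ x : D, x ≠ 0 → n ∣ idealWt w (Ideal.span {x}) := by
    intro x hx
    have h := mem_nonZeroDivisors_of_ne_zero (hsp0 hx)
    have h1 := hcls _ h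
    rw [(ClassGroup.mk0_eq_one_iff h).mpr ⟨x, rfl⟩] at h1
    rw [← hord]; exact orderOf_dvd_iff_pow_eq_one.mpr h1.symm
  have hunit : ∀ x : D, x ≠ 0 → idealWt w (Ideal.span {x}) = 0 → IsUnit x := by
    intro x hx h0
    have := idealWt_eq_zero w hw1 (hsp0 hx) h0
    rwa [Ideal.one_eq_top, Ideal.span_singleton_eq_top] at this
  have hunit' : ∀ x : D, IsUnit x → idealWt w (Ideal.span {x}) = 0 := by
    intro x hx
    rw [Ideal.span_singleton_eq_top.mpr hx, ← Ideal.one_eq_top, idealWt_one]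
  have hmulx : ∀ {x y : D}, x ≠ 0 → y ≠ 0 → idealWt w (Ideal.span {x * y}) =
      idealWt w (Ideal.span {x}) + idealWt w (Ideal.span {y}) := by
    intro x y hx hy
    rw [← Ideal.span_singleton_mul_span_singleton, hmul (hsp0 hx) (hsp0 hy)]
  have hirr_of : ∀ x : D, x ≠ 0 → idealWt w (Ideal.span {x}) = n → Irreducible x := by
    intro x hx hxn
    refine ⟨fun hu => ?_, ?_⟩
    · have := hunit' x hu; omega
    · rintro a b rfl
      have ha := left_ne_zero_of_mul hx
      have hb := right_ne_zero_of_mul hx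
      rw [hmulx ha hb] at hxn
      obtain ⟨i, hi⟩ := hprin' a ha
      rcases Nat.eq_zero_or_pos i with rfl | hi0
      · exact Or.inl (hunit a ha (by simpa using hi))
      · right
        apply hunit b hb
        have : n * 1 ≤ n * i := Nat.mul_le_mul_left n hi0
        omega
  have hPprime : Prime (P : Ideal D) := Ideal.prime_of_isPrime (nonZeroDivisors.coe_ne_zero P) hP
  have hwP : w (P : Ideal D) = 1 := by
    have h1 := hwc (P : Ideal D) P.2
    have h2 : g ^ 1 = g ^ w (P : Ideal D) := by rw [← h1, pow_one]
    rw [pow_inj_mod, hord] at h2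
    have h3 := hw1 (P : Ideal D)
    have h4 := hwn (P : Ideal D)
    rcases eq_or_lt_of_le (show 1 ≤ n from hn) with h5 | h5
    · omega
    · rw [Nat.mod_eq_of_lt h5] at h2
      rcases h4.eq_or_lt with h6 | h6
      · rw [h6, Nat.mod_self] at h2; omega
      · rw [Nat.mod_eq_of_lt h6] at h2; exact h2.symm
  -- every prime weight divides n
  have hdvd : ∀ Q : Ideal D, Prime Q → w Q ∣ n := by
    intro Q hQ
    obtain ⟨s, hs⟩ : ∃ s, s = w Q := ⟨_, rfl⟩
    have hs1 := hw1 Q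
    have hsn := hwn Q
    rw [← hs] at hs1 hsn ⊢
    obtain ⟨k, hk⟩ : ∃ k, k = n / s := ⟨_, rfl⟩
    obtain ⟨r, hr⟩ : ∃ r, r = n % s := ⟨_, rfl⟩
    have hkr : k * s + r = n := by rw [hk, hr]; exact Nat.div_add_mod' n s
    have hk0 : 0 < k := by rw [hk]; exact Nat.div_pos hsn hs1
    obtain ⟨m, hm⟩ : s.gcd n ∣ n := Nat.gcd_dvd_right _ _
    obtain ⟨s', hs'⟩ : s.gcd n ∣ s := Nat.gcd_dvd_left _ _
    obtain ⟨d, hd⟩ : ∃ d, d = s.gcd n := ⟨_, rfl⟩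
    have hd0 : 0 < d := by rw [hd]; exact Nat.gcd_pos_of_pos_left _ hs1
    have hcop : Nat.Coprime m s' := by
      have := Nat.coprime_div_gcd_div_gcd (hd ▸ hd0)
      have e1 : s / s.gcd n = s' := Nat.div_eq_of_eq_mul_right (hd ▸ hd0) hs'
      have e2 : n / s.gcd n = m := Nat.div_eq_of_eq_mul_right (hd ▸ hd0) hm
      rw [e1, e2] at this
      exact this.symm
    rw [← hd] at hm hs'
    have hQ0 := hQ.ne_zero
    have hP0 := hPprime.ne_zero
    have hwtQ : ∀ i, idealWt w (Q ^ i) = i * s := by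
      intro i; rw [idealWt_pow, idealWt_prime w hQ, hs]
    have hwtP : ∀ i, idealWt w ((P : Ideal D) ^ i) = i := by
      intro i; rw [idealWt_pow, idealWt_prime w hPprime, hwP, mul_one]
    have hwx : idealWt w (Q ^ k * (P : Ideal D) ^ r) = n := by
      rw [hmul (pow_ne_zero _ hQ0) (pow_ne_zero _ hP0), hwtQ, hwtP, hkr]
    obtain ⟨x, hx0, hx⟩ := hprin _ (mul_ne_zero (pow_ne_zero k hQ0) (pow_ne_zero r hP0))
      (by rw [hwx])
    have hxi := hirr_of x hx0 (by rw [← hx, hwx])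
    obtain ⟨y, hy0, hy⟩ := hprin _ (pow_ne_zero n hP0) (by rw [hwtP])
    have hyi := hirr_of y hy0 (by rw [← hy, hwtP])
    obtain ⟨u, hu0, hu⟩ := hprin _ (pow_ne_zero m hQ0) (by
      rw [hwtQ, hs', hm]; exact ⟨s', by ring⟩)
    have hm0 : 0 < m := by
      rcases Nat.eq_zero_or_pos m with h | h
      · rw [h] at hm; omega
      · exact h
    have hui : Irreducible u := by
      refine ⟨fun h => ?_, ?_⟩
      · have h1 := hunit' u h
        rw [← hu, hwtQ] at h1
        have := Nat.mul_pos hm0 hs1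
        omega
      · rintro a b rfl
        have ha := left_ne_zero_of_mul hu0
        have hb := right_ne_zero_of_mul hu0
        have hQa : Ideal.span {a} ∣ Q ^ m := by
          rw [hu, ← Ideal.span_singleton_mul_span_singleton]; exact dvd_mul_right _ _
        obtain ⟨i, him, hi⟩ := (dvd_prime_pow hQ m).mp hQa
        rw [associated_iff_eq] at hi
        have h1 := hprin' a ha
        have hw1' := hmulx ha hb
        rw [← hu, hwtQ, hi, hwtQ] at hw1'
        rw [hi, hwtQ, hm, hs', mul_left_comm] at h1
        have h2 : m ∣ i := hcop.dvd_of_dvd_mul_right (Nat.dvd_of_mul_dvd_mul_left hd0 h1)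
        rcases Nat.eq_zero_or_pos i with h | h
        · left; apply hunit a ha; rw [hi, hwtQ, h, zero_mul]
        · right; apply hunit b hb
          have : i = m := him.antisymm (Nat.le_of_dvd h h2)
          rw [this] at hw1'
          omega
    have hc := hfd_assoc hHFD (Multiset.replicate n x)
      (Multiset.replicate (k * d) u + Multiset.replicate r y)
      (fun p hp => by rwa [Multiset.eq_of_mem_replicate hp])
      (fun p hp => by
        rcases Multiset.mem_add.mp hp with h | h
        · rwa [Multiset.eq_of_mem_replicate h]
        · rwa [Multiset.eq_of_mem_replicate h])
      (by
        intro h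
        have := congrArg Multiset.card h
        simp at this
        omega)
      (by
        rw [← Ideal.span_singleton_eq_span_singleton]
        simp only [Multiset.prod_add, Multiset.prod_replicate]
        rw [← Ideal.span_singleton_mul_span_singleton, ← Ideal.span_singleton_pow,
          ← Ideal.span_singleton_pow, ← Ideal.span_singleton_pow, ← hx, ← hy, ← hu,
          mul_pow, ← pow_mul, ← pow_mul, ← pow_mul, ← pow_mul]
        congr 2
        · rw [hm]; ring
        · ring)
    simp only [Multiset.card_replicate, Multiset.card_add] at hc
    have hks : k * s = k * d := by omega
    have hsd : s = d := Nat.eq_of_mul_eq_mul_left hk0 hks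
    rw [hsd, hm]; exact dvd_mul_right _ _
  -- ideals of weight at least n have divisors of weight n
  have hsub : ∀ J : Ideal D, J ≠ 0 → n ≤ idealWt w J → ∃ V : Ideal D, V ∣ J ∧ idealWt w V = n := by
    intro J hJ hJn
    have hpr : ∀ Q ∈ UniqueFactorizationMonoid.normalizedFactors J, Prime Q := fun Q hQ =>
      UniqueFactorizationMonoid.prime_of_normalized_factor Q hQ
    obtain ⟨N, hN, hNs⟩ := exists_sub_sum w n (UniqueFactorizationMonoid.normalizedFactors J)
      hn (fun Q hQ => hdvd Q (hpr Q hQ))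
      (fun A hA B hB => hchain _ _
        ⟨hw1 A, hwn A, ⟨A, mem_nonZeroDivisors_of_ne_zero (hpr A hA).ne_zero⟩,
          Ideal.isPrime_of_prime (hpr A hA), hwc A _⟩
        ⟨hw1 B, hwn B, ⟨B, mem_nonZeroDivisors_of_ne_zero (hpr B hB).ne_zero⟩,
          Ideal.isPrime_of_prime (hpr B hB), hwc B _⟩) hJn
    refine ⟨N.prod, ?_, ?_⟩
    · conv_rhs => rw [← Ideal.prod_normalizedFactors_eq_self hJ]
      exact Multiset.prod_dvd_prod_of_le hN
    · rw [idealWt_prod w N (fun Q hQ => hpr Q (Multiset.mem_of_le hN hQ)), hNs]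
  have hge : ∀ x : D, x ≠ 0 → ¬ IsUnit x → n ≤ idealWt w (Ideal.span {x}) := by
    intro x hx hxu
    refine Nat.le_of_dvd (Nat.pos_of_ne_zero fun h => hxu (hunit x hx h)) (hprin' x hx)
  have hirr : ∀ x : D, Irreducible x → idealWt w (Ideal.span {x}) = n := by
    intro x hx
    obtain ⟨V, hV, hVn⟩ := hsub _ (hsp0 hx.ne_zero) (hge x hx.ne_zero hx.not_isUnit)
    obtain ⟨v, hv0, hv⟩ := hprin V (ne_zero_of_dvd_ne_zero (hsp0 hx.ne_zero) hV) (by rw [hVn])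
    rw [hv] at hV hVn
    have hvx : v ∣ x := Ideal.span_singleton_le_span_singleton.mp (Ideal.dvd_iff_le.mp hV)
    have := (hirr_of v hv0 hVn).associated_of_dvd hx hvx
    rw [← Ideal.span_singleton_eq_span_singleton.mpr this, hVn]
  refine ⟨inferInstance, hHFD.2.1, ?_⟩
  intro z p q hz hzu hp hq hpz hqz hpq
  have hpn := hirr p hp
  have hqn := hirr q hq
  have hz2 : 2 * n ≤ idealWt w (Ideal.span {z}) := by
    obtain ⟨i, hi⟩ := hprin' z hz
    have h1 := hge z hz hzu
    by_cases hi1 : i = 1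
    · exfalso
      have := hirr_of z hz (by rw [hi, hi1, mul_one])
      exact hpq ((hp.associated_of_dvd this hpz).trans (hq.associated_of_dvd this hqz).symm)
    · rcases Nat.eq_zero_or_pos i with rfl | h0
      · omega
      · rw [hi, mul_comm]; exact Nat.mul_le_mul_left n (by omega)
  obtain ⟨I, hI⟩ : ∃ I, I = Ideal.span {p} ⊓ Ideal.span {q} := ⟨_, rfl⟩
  obtain ⟨J, hJ⟩ : I ∣ Ideal.span {z} := by
    rw [Ideal.dvd_iff_le, hI]
    exact le_inf (Ideal.span_singleton_le_span_singleton.mpr hpz)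
      (Ideal.span_singleton_le_span_singleton.mpr hqz)
  have hIJ : I * J ≠ 0 := hJ ▸ hsp0 hz
  have hI0 := left_ne_zero_of_mul hIJ
  have hJ0 := right_ne_zero_of_mul hIJ
  have hI2 : idealWt w I ≤ 2 * n := by
    obtain ⟨K, hK⟩ : I ∣ Ideal.span {p} * Ideal.span {q} := by
      rw [Ideal.dvd_iff_le, hI]; exact Ideal.mul_le_inf
    have hne := mul_ne_zero (hsp0 hp.ne_zero) (hsp0 hq.ne_zero)
    have h1 := hmul (hsp0 hp.ne_zero) (hsp0 hq.ne_zero)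
    rw [hK] at hne
    rw [hK, hmul hI0 (right_ne_zero_of_mul hne), hpn, hqn] at h1
    omega
  have hshrink : ∀ (N : ℕ) (J : Ideal D), J ≠ 0 → idealWt w I + idealWt w J = 2 * n + n * N →
      ∃ J', J' ∣ J ∧ idealWt w I + idealWt w J' = 2 * n := by
    intro N
    induction N with
    | zero => intro J _ h; exact ⟨J, dvd_rfl, by simpa using h⟩
    | succ N ih =>
      intro J hJ h
      rw [Nat.mul_succ] at h
      obtain ⟨V, ⟨J1, rfl⟩, hVn⟩ := hsub J hJ (by omega)
      have h1 := right_ne_zero_of_mul hJ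
      rw [hmul (left_ne_zero_of_mul hJ) h1] at h
      obtain ⟨J', hd, hJ'⟩ := ih J1 h1 (by omega)
      exact ⟨J', hd.mul_left V, hJ'⟩
  obtain ⟨J', hJ'd, hJ'⟩ : ∃ J', J' ∣ J ∧ idealWt w I + idealWt w J' = 2 * n := by
    obtain ⟨i, hi⟩ := hprin' z hz
    have hi2 : 2 ≤ i := by
      rw [hi, mul_comm 2 n] at hz2
      exact Nat.le_of_mul_le_mul_left hz2 hn
    obtain ⟨j, rfl⟩ := Nat.exists_eq_add_of_le hi2
    apply hshrink j J hJ0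
    rw [← hmul hI0 hJ0, ← hJ, hi]; ring
  have hJ'0 := ne_zero_of_dvd_ne_zero hJ0 hJ'd
  have hwt := hmul hI0 hJ'0
  rw [hJ'] at hwt
  obtain ⟨v, hv0, hv⟩ := hprin (I * J') (mul_ne_zero hI0 hJ'0) (by rw [hwt]; exact dvd_mul_left _ _)
  have hvI : Ideal.span {v} ≤ I := hv ▸ Ideal.mul_le_left
  have hvz : v ∣ z := by
    rw [← Ideal.span_singleton_le_span_singleton, ← hv, hJ]
    exact Ideal.dvd_iff_le.mp (mul_dvd_mul_left I hJ'd)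
  obtain ⟨p', hp'⟩ : p ∣ v := by
    rw [← Ideal.span_singleton_le_span_singleton]
    exact hvI.trans (hI ▸ inf_le_left)
  obtain ⟨q', hq'⟩ : q ∣ v := by
    rw [← Ideal.span_singleton_le_span_singleton]
    exact hvI.trans (hI ▸ inf_le_right)
  rw [hv] at hwt
  have hp'0 : p' ≠ 0 := by rintro rfl; simp at hp'; exact hv0 hp'
  have hq'0 : q' ≠ 0 := by rintro rfl; simp at hq'; exact hv0 hq'
  refine ⟨p', q', hirr_of p' hp'0 ?_, hirr_of q' hq'0 ?_, ?_, ?_⟩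
  · rw [hp', hmulx hp.ne_zero hp'0, hpn] at hwt; omega
  · rw [hq', hmulx hq.ne_zero hq'0, hqn] at hwt; omega
  · rw [← hp', ← hq']
  · rw [← hq']; exact hvz
end
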